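/- arXiv:2311.03548 — 2 statements merged into one kernel-verified Lean document; each statement's English description precedes it below -/
import Mathlib

section
/- Let (X,0) ⊂ (ℂⁿ,0) be a reduced analytic variety, f ∈ O_n with finite relative Bruce–Roberts number μ⁻_BR(f,X) = dim_ℂ O_n/(df(Θ_X) + I_X), and h ∈ O_t with finite Milnor number μ(h). Define F ∈ O_{n+t} by F(x,y) = f(x) + h(y) on the suspension X̃ = X × ℂᵗ. Then μ⁻_BR(F, X̃) = μ(h) · μ⁻_BR(f, X). -/
/-!  STATEMENT 8 (Sebastiani–Thom property of the relative Bruce–Roberts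
number).  `O_n = MvPowerSeries (Fin n) ℂ`, `O_t = MvPowerSeries (Fin t) ℂ`,
`O_{n+t} = MvPowerSeries (Fin n ⊕ Fin t) ℂ`; `pd` is the partial derivative;
`inclL`/`inclR` are the two inclusions into `O_{n+t}`.  For a reduced variety
`(X,0)` with ideal `I_X`, tangent vector fields `Θ_X`, a function `f ∈ O_n`
with finite `μ⁻_BR(f,X) = dim_ℂ O_n/(df(Θ_X)+I_X)`, and `h ∈ O_t` with finite
Milnor number, the function `F(x,y) = f(x) + h(y)` on the suspension
`X̃ = X × ℂᵗ` satisfies `μ⁻_BR(F,X̃) = μ(h) · μ⁻_BR(f,X)`. -/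

noncomputable def pd {σ : Type*} [DecidableEq σ] (i : σ)
    (f : MvPowerSeries σ ℂ) : MvPowerSeries σ ℂ :=
  fun m => ((m i : ℂ) + 1) * f (m + Finsupp.single i 1)

open scoped Classical in
/-- Inclusion `O_n → O_{n+t}` of power series in the first block of variables. -/
noncomputable def inclL {n t : ℕ} (f : MvPowerSeries (Fin n) ℂ) :
    MvPowerSeries (Fin n ⊕ Fin t) ℂ :=
  fun m =>
    if ∀ j : Fin t, m (Sum.inr j) = 0 then
      f (m.comapDomain Sum.inl Sum.inl_injective.injOn)
    else 0

open scoped Classical in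
/-- Inclusion `O_t → O_{n+t}` of power series in the second block of variables. -/
noncomputable def inclR {n t : ℕ} (h : MvPowerSeries (Fin t) ℂ) :
    MvPowerSeries (Fin n ⊕ Fin t) ℂ :=
  fun m =>
    if ∀ i : Fin n, m (Sum.inl i) = 0 then
      h (m.comapDomain Sum.inr Sum.inr_injective.injOn)
    else 0

/-- The set of vector fields tangent to the variety with ideal `I`. -/
def ThetaSet {σ : Type*} [DecidableEq σ] [Fintype σ]
    (I : Ideal (MvPowerSeries σ ℂ)) : Set (σ → MvPowerSeries σ ℂ) :=
  {ξ | ∀ h ∈ I, (∑ i : σ, ξ i * pd i h) ∈ I}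

/-- The ideal `dg(Θ) ⊆ O`, for a set `Θ` of vector fields. -/
noncomputable def dIdeal {σ : Type*} [DecidableEq σ] [Fintype σ]
    (g : MvPowerSeries σ ℂ) (Θ : Set (σ → MvPowerSeries σ ℂ)) :
    Ideal (MvPowerSeries σ ℂ) :=
  Ideal.span ((fun ξ => ∑ i : σ, ξ i * pd i g) '' Θ)

namespace ST8

open MvPowerSeries

variable {n t : ℕ}

abbrev OL (n : ℕ) := MvPowerSeries (Fin n) ℂ
abbrev OS (n t : ℕ) := MvPowerSeries (Fin n ⊕ Fin t) ℂ

/-- The coefficient of `y^q`. -/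
noncomputable def sl (q : Fin t →₀ ℕ) : OS n t →ₗ[ℂ] OL n where
  toFun c := fun p => c (p.sumElim q)
  map_add' _ _ := rfl
  map_smul' _ _ := rfl

lemma sl_apply (q : Fin t →₀ ℕ) (c : OS n t) (p : Fin n →₀ ℕ) :
    sl q c p = c (p.sumElim q) := rfl

lemma ext_sl {c d : OS n t} (H : ∀ q, sl q c = sl q d) : c = d := by
  funext m
  have := congrFun (H (m.comapDomain Sum.inr Sum.inr_injective.injOn))
    (m.comapDomain Sum.inl Sum.inl_injective.injOn)
  simpa [sl_apply] using this

lemma sl_mul (q : Fin t →₀ ℕ) (c d : OS n t) :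
    sl q (c * d) = ∑ x ∈ Finset.HasAntidiagonal.antidiagonal q, sl x.1 c * sl x.2 d := by
  classical
  ext p
  rw [map_sum]
  simp only [coeff_mul]
  change coeff (p.sumElim q) (c * d) = _
  rw [coeff_mul, ← Finsupp.image_sumElim_product_antidiagonal, Finset.sum_image,
    Finset.sum_product_right]
  · rfl
  · rintro ⟨⟨a, b⟩, e, f⟩ _ ⟨⟨a', b'⟩, e', f'⟩ _ hh
    simp only [Prod.mk.injEq] at hh ⊢
    have h1 := congrArg (fun m => m.comapDomain Sum.inl Sum.inl_injective.injOn) hh.1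
    have h2 := congrArg (fun m => m.comapDomain Sum.inr Sum.inr_injective.injOn) hh.1
    have h3 := congrArg (fun m => m.comapDomain Sum.inl Sum.inl_injective.injOn) hh.2
    have h4 := congrArg (fun m => m.comapDomain Sum.inr Sum.inr_injective.injOn) hh.2
    simp only [Finsupp.comapDomain_inl_sumElim, Finsupp.comapDomain_inr_sumElim] at h1 h2 h3 h4
    exact ⟨⟨h1, h3⟩, h2, h4⟩

lemma sl_inclL (q : Fin t →₀ ℕ) (g : OL n) :
    sl q (inclL g) = if q = 0 then g else 0 := by
  classical
  funext p
  rw [sl_apply, inclL]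
  have : (∀ j : Fin t, (p.sumElim q) (Sum.inr j) = 0) ↔ q = 0 := by
    simp [Finsupp.ext_iff]
  by_cases hq : q = 0
  · rw [if_pos (this.2 hq), if_pos hq]; simp
  · rw [if_neg (fun hh => hq (this.1 hh)), if_neg hq]; rfl

lemma sl_inclR (q : Fin t →₀ ℕ) (k : OL t) :
    sl q (inclR k : OS n t) = C (k q) := by
  classical
  funext p
  rw [sl_apply, inclR]
  have : (∀ j : Fin n, (p.sumElim q) (Sum.inl j) = 0) ↔ p = 0 := by
    simp [Finsupp.ext_iff]
  have hc : (C (k q) : OL n) p = if p = 0 then k q else 0 := coeff_C p (k q)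
  rw [hc]
  by_cases hq : p = 0
  · rw [if_pos (this.2 hq), if_pos hq]; simp
  · rw [if_neg (fun hh => hq (this.1 hh)), if_neg hq]

lemma sl_inclL_mul (q : Fin t →₀ ℕ) (g : OL n) (c : OS n t) :
    sl q (inclL g * c) = g * sl q c := by
  classical
  rw [sl_mul, Finset.sum_eq_single (0, q)]
  · simp [sl_inclL]
  · rintro ⟨a, b⟩ hab hne
    rw [sl_inclL, if_neg, zero_mul]
    rintro rfl
    simp at hab
    exact hne (by simp [hab])
  · simp

lemma sl_mul_inclL (q : Fin t →₀ ℕ) (g : OL n) (c : OS n t) :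
    sl q (c * inclL g) = sl q c * g := by
  rw [mul_comm, sl_inclL_mul, mul_comm]

lemma inclL_mul (a b : OL n) : (inclL (a * b) : OS n t) = inclL a * inclL b := by
  refine ext_sl fun q => ?_
  rw [sl_inclL_mul, sl_inclL, sl_inclL]; split_ifs <;> simp

lemma inclL_add (a b : OL n) : (inclL (a + b) : OS n t) = inclL a + inclL b := by
  refine ext_sl fun q => ?_
  rw [map_add, sl_inclL, sl_inclL, sl_inclL]; split_ifs <;> simp

lemma inclL_zero : (inclL (0 : OL n) : OS n t) = 0 := by
  refine ext_sl fun q => ?_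
  rw [sl_inclL]; simp

lemma inclL_sum {ι : Type*} (s : Finset ι) (g : ι → OL n) :
    (inclL (∑ i ∈ s, g i) : OS n t) = ∑ i ∈ s, inclL (g i) :=
  map_sum (⟨⟨inclL, inclL_zero⟩, inclL_add⟩ : OL n →+ OS n t) g s

lemma inclR_mul (a b : OL t) : (inclR (a * b) : OS n t) = inclR a * inclR b := by
  classical
  refine ext_sl fun q => ?_
  rw [sl_mul]
  simp only [sl_inclR, ← map_mul, ← map_sum]
  congr 1
  exact coeff_mul q a b

lemma inclR_add (a b : OL t) : (inclR (a + b) : OS n t) = inclR a + inclR b := by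
  refine ext_sl fun q => ?_
  rw [map_add, sl_inclR, sl_inclR, sl_inclR, ← map_add]; rfl

lemma inclR_zero : (inclR (0 : OL t) : OS n t) = 0 := by
  refine ext_sl fun q => ?_
  rw [sl_inclR, map_zero]; exact map_zero _

/-- Series with prescribed `y`-coefficients. -/
noncomputable def mkS (u : (Fin t →₀ ℕ) → OL n) : OS n t := fun m =>
  u (m.comapDomain Sum.inr Sum.inr_injective.injOn)
    (m.comapDomain Sum.inl Sum.inl_injective.injOn)

lemma sl_mkS (u : (Fin t →₀ ℕ) → OL n) (q : Fin t →₀ ℕ) : sl q (mkS u) = u q := by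
  funext p
  simp [sl_apply, mkS]

lemma mem_span_iff (J : Ideal (OL n)) (c : OS n t) :
    c ∈ Ideal.span (inclL '' (J : Set (OL n))) ↔ ∀ q, sl q c ∈ J := by
  constructor
  · intro hc
    induction hc using Submodule.closure_induction with
    | zero => intro q; simp
    | add x y _ _ hx hy => intro q; rw [map_add]; exact J.add_mem (hx q) (hy q)
    | smul_mem r x hx =>
      obtain ⟨g, hg, rfl⟩ := hx
      intro q
      rw [smul_eq_mul, sl_mul_inclL]
      exact J.mul_mem_left _ hg
  · intro H
    obtain ⟨s, hs⟩ := (isNoetherianRing_iff_ideal_fg _).1 (inferInstance : IsNoetherianRing (OL n)) J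
    have key : ∀ q, ∃ a : OL n → OL n, ∑ g ∈ s, a g * g = sl q c := by
      intro q
      have := H q
      rw [← hs, Submodule.mem_span_finset] at this
      obtain ⟨a, -, ha⟩ := this
      exact ⟨a, ha⟩
    choose a ha using key
    have : c = ∑ g ∈ s, mkS (fun q => a q g) * inclL g := by
      refine ext_sl fun q => ?_
      rw [map_sum, ← ha q]
      simp only [sl_mul_inclL, sl_mkS]
    rw [this]
    refine Ideal.sum_mem _ fun g hg => Ideal.mul_mem_left _ _ (Ideal.subset_span ⟨g, ?_, rfl⟩)
    rw [← hs]
    exact Submodule.subset_span hg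

lemma sl_pd_inl (q : Fin t →₀ ℕ) (i : Fin n) (c : OS n t) :
    sl q (pd (Sum.inl i) c) = pd i (sl q c) := by
  funext p
  rw [sl_apply]
  simp only [pd, sl_apply]
  congr 2
  rw [← Finsupp.sumElim_single_zero, ← Finsupp.sumElim_add, add_zero]

lemma sl_pd_inr (q : Fin t →₀ ℕ) (j : Fin t) (c : OS n t) :
    sl q (pd (Sum.inr j) c) = ((q j : ℂ) + 1) • sl (q + Finsupp.single j 1) c := by
  funext p
  rw [sl_apply]
  change _ = ((q j : ℂ) + 1) * sl (q + Finsupp.single j 1) c p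
  simp only [pd, sl_apply]
  congr 2
  rw [← Finsupp.sumElim_zero_single, ← Finsupp.sumElim_add, add_zero]

lemma pd_zero {σ : Type*} [DecidableEq σ] (i : σ) : pd i (0 : MvPowerSeries σ ℂ) = 0 := by
  funext m
  exact mul_zero _

lemma pd_add {σ : Type*} [DecidableEq σ] (i : σ) (a b : MvPowerSeries σ ℂ) :
    pd i (a + b) = pd i a + pd i b := by
  funext m
  exact mul_add _ _ _

lemma pd_C {σ : Type*} [DecidableEq σ] (i : σ) (a : ℂ) :
    pd i (C a : MvPowerSeries σ ℂ) = 0 := by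
  funext m
  change _ * coeff (m + Finsupp.single i 1) (C a) = 0
  rw [coeff_C, if_neg, mul_zero]
  intro hh
  have := DFunLike.congr_fun hh i
  simp at this

lemma pd_inl_inclL (i : Fin n) (g : OL n) :
    pd (Sum.inl i) (inclL g : OS n t) = inclL (pd i g) := by
  refine ext_sl fun q => ?_
  rw [sl_pd_inl, sl_inclL, sl_inclL]; split_ifs
  · rfl
  · exact pd_zero i

lemma pd_inr_inclL (j : Fin t) (g : OL n) :
    pd (Sum.inr j) (inclL g : OS n t) = 0 := by
  refine ext_sl fun q => ?_
  rw [sl_pd_inr, sl_inclL, if_neg, smul_zero, map_zero]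
  intro hh
  have := DFunLike.congr_fun hh j
  simp at this

lemma pd_inl_inclR (i : Fin n) (g : OL t) :
    pd (Sum.inl i) (inclR g : OS n t) = 0 := by
  refine ext_sl fun q => ?_
  rw [sl_pd_inl, sl_inclR, pd_C, map_zero]

lemma pd_inr_inclR (j : Fin t) (g : OL t) :
    pd (Sum.inr j) (inclR g : OS n t) = inclR (pd j g) := by
  refine ext_sl fun q => ?_
  rw [sl_pd_inr, sl_inclR, sl_inclR, smul_eq_C_mul, ← map_mul]
  rfl

lemma dF_eq (f : OL n) (h : OL t) (ξ : Fin n ⊕ Fin t → OS n t) :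
    ∑ i, ξ i * pd i (inclL f + inclR h) =
      ∑ i, ξ (Sum.inl i) * inclL (pd i f) + ∑ j, ξ (Sum.inr j) * inclR (pd j h) := by
  rw [Fintype.sum_sum_type]
  simp only [pd_add, pd_inl_inclL, pd_inr_inclL, pd_inl_inclR, pd_inr_inclR, add_zero, zero_add]

variable (I : Ideal (OL n)) (f : OL n) (h : OL t)

/-- the ideal of the suspension -/
noncomputable abbrev IS (t : ℕ) (I : Ideal (OL n)) : Ideal (OS n t) :=
  Ideal.span (inclL '' (I : Set (OL n)))

lemma theta_slice {ξ : Fin n ⊕ Fin t → OS n t} (hξ : ξ ∈ ThetaSet (IS t I)) (q : Fin t →₀ ℕ) :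
    (fun i => sl q (ξ (Sum.inl i))) ∈ ThetaSet I := by
  intro g hg
  have h1 := hξ (inclL g) (Ideal.subset_span ⟨g, hg, rfl⟩)
  have h2 := (mem_span_iff I _).1 h1 q
  rw [Fintype.sum_sum_type] at h2
  simpa only [pd_inl_inclL, pd_inr_inclL, mul_zero, Finset.sum_const_zero, add_zero, map_sum,
    sl_mul_inclL] using h2

lemma theta_smul {σ : Type*} [DecidableEq σ] [Fintype σ] {I : Ideal (MvPowerSeries σ ℂ)}
    {ξ : σ → MvPowerSeries σ ℂ} (hξ : ξ ∈ ThetaSet I) (c : MvPowerSeries σ ℂ) :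
    (fun i => c * ξ i) ∈ ThetaSet I := by
  intro g hg
  have := I.mul_mem_left c (hξ g hg)
  simpa only [Finset.mul_sum, mul_assoc] using this

lemma theta_inclL {ξ : Fin n → OL n} (hξ : ξ ∈ ThetaSet I) :
    (Sum.elim (fun i => inclL (ξ i)) (fun _ => 0) : Fin n ⊕ Fin t → OS n t)
      ∈ ThetaSet (IS t I) := by
  intro g hg
  rw [mem_span_iff] at hg ⊢
  intro q
  rw [Fintype.sum_sum_type]
  simp only [Sum.elim_inl, Sum.elim_inr, zero_mul, Finset.sum_const_zero, add_zero, map_sum,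
    sl_inclL_mul, sl_pd_inl]
  exact hξ _ (hg q)

lemma theta_inr (j : Fin t) :
    (Pi.single (Sum.inr j) 1 : Fin n ⊕ Fin t → OS n t) ∈ ThetaSet (IS t I) := by
  intro g hg
  have : ∑ i, (Pi.single (Sum.inr j) 1 : Fin n ⊕ Fin t → OS n t) i * pd i g
      = pd (Sum.inr j) g := by
    rw [Finset.sum_eq_single (Sum.inr j)]
    · simp
    · intro b _ hb; simp [Pi.single_eq_of_ne hb]
    · simp
  rw [this]
  rw [mem_span_iff] at hg ⊢
  intro q
  rw [sl_pd_inr, smul_eq_C_mul]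
  exact I.mul_mem_left _ (hg _)

noncomputable abbrev NN : Ideal (OS n t) :=
  dIdeal (inclL f + inclR h) (ThetaSet (IS t I)) ⊔ IS t I

noncomputable abbrev JJ : Ideal (OL n) := dIdeal f (ThetaSet I) ⊔ I

noncomputable abbrev KK : Ideal (OL t) := Ideal.span (Set.range (fun j : Fin t => pd j h))

lemma inclR_mem {k : OL t} (hk : k ∈ KK h) : inclR k ∈ NN I f h := by
  induction hk using Submodule.closure_induction with
  | zero => rw [inclR_zero]; exact zero_mem _
  | add x y _ _ hx hy => rw [inclR_add]; exact add_mem hx hy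
  | smul_mem r x hx =>
    obtain ⟨j, rfl⟩ := hx
    rw [smul_eq_mul, inclR_mul]
    refine Ideal.mul_mem_left _ _ (Ideal.mem_sup_left (Ideal.subset_span
      ⟨_, theta_inr I j, ?_⟩))
    simp only [dF_eq]
    rw [Finset.sum_eq_single j]
    · simp
    · intro b _ hb
      rw [Pi.single_eq_of_ne (by simpa using hb), zero_mul]
    · simp

lemma inclL_mem {g : OL n} (hg : g ∈ JJ I f) : inclL g ∈ NN I f h := by
  obtain ⟨a, ha, b, hb, rfl⟩ := Submodule.mem_sup.1 hg
  rw [inclL_add]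
  refine add_mem ?_ (Ideal.mem_sup_right (Ideal.subset_span ⟨b, hb, rfl⟩))
  clear hg
  induction ha using Submodule.closure_induction with
  | zero => rw [inclL_zero]; exact zero_mem _
  | add x y _ _ hx hy => rw [inclL_add]; exact add_mem hx hy
  | smul_mem r x hx =>
    obtain ⟨ξ, hξ, rfl⟩ := hx
    rw [smul_eq_mul, inclL_mul]
    refine Ideal.mul_mem_left _ _ (Ideal.mem_sup_left (Ideal.subset_span
      ⟨_, theta_inclL I hξ, ?_⟩))
    simp only [dF_eq]
    simp [inclL_sum, inclL_mul]

lemma slices_mem {c : OS n t} (hc : ∀ q, sl q c ∈ JJ I f) : c ∈ NN I f h := by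
  have h1 := (mem_span_iff (JJ I f) c).2 hc
  refine (Ideal.span_le.2 ?_ : Ideal.span _ ≤ NN I f h) h1
  rintro _ ⟨g, hg, rfl⟩
  exact inclL_mem I f h hg

section phi

variable {I f} {r : ℕ} (b : Module.Basis (Fin r) ℂ (OL n ⧸ JJ I f))

/-- coordinates of `y`-coefficients -/
noncomputable def lam (s : Fin r) : OS n t →ₗ[ℂ] OL t where
  toFun c := fun q => b.coord s (Ideal.Quotient.mkₐ ℂ (JJ I f) (sl q c))
  map_add' x y := by
    funext q
    simp only [map_add]
    rfl
  map_smul' x y := by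
    funext q
    simp only [map_smul]
    rfl

lemma lam_apply (s : Fin r) (c : OS n t) (q : Fin t →₀ ℕ) :
    lam b s c q = b.coord s (Ideal.Quotient.mkₐ ℂ (JJ I f) (sl q c)) := rfl

lemma lam_mul_inclR (s : Fin r) (c : OS n t) (k : OL t) :
    lam b s (c * inclR k) = lam b s c * k := by
  classical
  funext q
  change _ = coeff q (lam b s c * k)
  rw [coeff_mul, lam_apply, sl_mul]
  simp only [map_sum]
  refine Finset.sum_congr rfl fun x _ => ?_
  rw [sl_inclR, mul_comm, ← smul_eq_C_mul, map_smul, map_smul, smul_eq_mul, mul_comm]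
  rfl

lemma lam_eq_zero (s : Fin r) {c : OS n t} (hc : ∀ q, sl q c ∈ JJ I f) : lam b s c = 0 := by
  funext q
  have : Ideal.Quotient.mkₐ ℂ (JJ I f) (sl q c) = 0 := Ideal.Quotient.eq_zero_iff_mem.2 (hc q)
  rw [lam_apply, this, map_zero]; rfl

lemma lam_mem (s : Fin r) {c : OS n t} (hc : c ∈ NN I f h) : lam b s c ∈ KK h := by
  obtain ⟨x, hx, y, hy, rfl⟩ := Submodule.mem_sup.1 hc
  rw [map_add]
  refine add_mem ?_ ?_
  · clear hc
    induction hx using Submodule.closure_induction with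
    | zero => rw [map_zero]; exact zero_mem _
    | add x y _ _ hx hy => rw [map_add]; exact add_mem hx hy
    | smul_mem r x hx =>
      obtain ⟨ξ, hξ, rfl⟩ := hx
      have hξ' := theta_smul hξ r
      have e : r • (∑ i, ξ i * pd i (inclL f + inclR h)) =
          ∑ i, (r * ξ i) * pd i (inclL f + inclR h) := by
        simp only [smul_eq_mul, Finset.mul_sum, mul_assoc]
      simp only [e]
      rw [dF_eq f h (fun i => r * ξ i), map_add]
      refine add_mem ?_ ?_
      · rw [lam_eq_zero]
        · exact zero_mem _
        · intro q
          refine Ideal.mem_sup_left (Ideal.subset_span ⟨_, theta_slice I hξ' q, ?_⟩)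
          simp only [map_sum, sl_mul_inclL]
      · rw [map_sum]
        refine Ideal.sum_mem _ fun j _ => ?_
        rw [lam_mul_inclR]
        exact Ideal.mul_mem_left _ _ (Ideal.subset_span ⟨j, rfl⟩)
  · rw [lam_eq_zero]
    · exact zero_mem _
    · intro q
      exact Ideal.mem_sup_right ((mem_span_iff I y).1 hy q)

lemma exists_lift : ∃ E : Fin r → OL n, ∀ s, Ideal.Quotient.mkₐ ℂ (JJ I f) (E s) = b s := by
  choose E hE using fun s => Ideal.Quotient.mkₐ_surjective ℂ (JJ I f) (b s)
  exact ⟨E, hE⟩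

lemma mk_sl_sum {E : Fin r → OL n} (hE : ∀ s, Ideal.Quotient.mkₐ ℂ (JJ I f) (E s) = b s)
    (u : Fin r → OL t) (q : Fin t →₀ ℕ) :
    Ideal.Quotient.mkₐ ℂ (JJ I f) (sl q (∑ s, inclL (E s) * inclR (u s))) =
      ∑ s, u s q • b s := by
  rw [map_sum, map_sum]
  refine Finset.sum_congr rfl fun s _ => ?_
  rw [sl_inclL_mul, sl_inclR, mul_comm, ← smul_eq_C_mul, map_smul, hE]

noncomputable def phi : OS n t →ₗ[ℂ] (Fin r → OL t ⧸ KK h) :=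
  LinearMap.pi fun s => (Ideal.Quotient.mkₐ ℂ (KK h)).toLinearMap ∘ₗ lam b s

lemma phi_surj : Function.Surjective (phi h b) := by
  intro v
  choose u hu using fun s => Ideal.Quotient.mkₐ_surjective ℂ (KK h) (v s)
  obtain ⟨E, hE⟩ := exists_lift b
  refine ⟨∑ s, inclL (E s) * inclR (u s), ?_⟩
  funext s
  rw [← hu s]
  change Ideal.Quotient.mkₐ ℂ (KK h) (lam b s _) = _
  congr 1
  funext q
  rw [lam_apply, mk_sl_sum b hE, Module.Basis.coord_apply, Module.Basis.repr_sum_self]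

lemma ker_phi : LinearMap.ker (phi h b) = (NN I f h).restrictScalars ℂ := by
  ext c
  have h1 : c ∈ LinearMap.ker (phi h b) ↔ ∀ s, lam b s c ∈ KK h := by
    rw [LinearMap.mem_ker, funext_iff]
    exact forall_congr' fun s => Ideal.Quotient.eq_zero_iff_mem
  rw [h1, Submodule.restrictScalars_mem]
  refine ⟨fun H => ?_, fun hc s => lam_mem h b s hc⟩
  obtain ⟨E, hE⟩ := exists_lift b
  have h2 : ∑ s, inclL (E s) * inclR (lam b s c) ∈ NN I f h :=
    Ideal.sum_mem _ fun s _ => Ideal.mul_mem_left _ _ (inclR_mem I f h (H s))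
  rw [← sub_add_cancel c (∑ s, inclL (E s) * inclR (lam b s c))]
  refine add_mem (slices_mem I f h fun q => ?_) h2
  rw [← Ideal.Quotient.eq_zero_iff_mem]
  change Ideal.Quotient.mkₐ ℂ (JJ I f) _ = 0
  rw [map_sub, map_sub, mk_sl_sum b hE, sub_eq_zero]
  exact (b.sum_repr _).symm

end phi

end ST8

theorem stmt8 (n t : ℕ)
    (IX : Ideal (MvPowerSeries (Fin n) ℂ))
    -- `(X,0)` is reduced
    (hred : IX.IsRadical)
    (f : MvPowerSeries (Fin n) ℂ) (h : MvPowerSeries (Fin t) ℂ)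
    -- `μ⁻_BR(f,X)` is finite
    (hμBR : FiniteDimensional ℂ (MvPowerSeries (Fin n) ℂ ⧸
      (dIdeal f (ThetaSet IX) ⊔ IX)))
    -- `μ(h)` is finite
    (hμh : FiniteDimensional ℂ (MvPowerSeries (Fin t) ℂ ⧸
      Ideal.span (Set.range (fun j : Fin t => pd j h))))
    (F : MvPowerSeries (Fin n ⊕ Fin t) ℂ)
    -- `F(x,y) = f(x) + h(y)`
    (hF : F = inclL f + inclR h)
    (IXt : Ideal (MvPowerSeries (Fin n ⊕ Fin t) ℂ))
    -- the ideal of the suspension `X̃ = X × ℂᵗ`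
    (hIXt : IXt = Ideal.span (inclL '' (IX : Set (MvPowerSeries (Fin n) ℂ)))) :
    -- `μ⁻_BR(F, X̃) = μ(h) · μ⁻_BR(f, X)`
    Module.finrank ℂ (MvPowerSeries (Fin n ⊕ Fin t) ℂ ⧸
        (dIdeal F (ThetaSet IXt) ⊔ IXt)) =
      Module.finrank ℂ (MvPowerSeries (Fin t) ℂ ⧸
          Ideal.span (Set.range (fun j : Fin t => pd j h))) *
        Module.finrank ℂ (MvPowerSeries (Fin n) ℂ ⧸
          (dIdeal f (ThetaSet IX) ⊔ IX)) := by
  subst hF hIXt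
  have b := Module.finBasis ℂ (MvPowerSeries (Fin n) ℂ ⧸ (dIdeal f (ThetaSet IX) ⊔ IX))
  have e1 := (ST8.phi h b).quotKerEquivOfSurjective (ST8.phi_surj h b)
  have e2 := Submodule.quotEquivOfEq _ _ (ST8.ker_phi h b)
  have e3 := Submodule.Quotient.restrictScalarsEquiv ℂ (ST8.NN IX f h)
  have e4 := (e3.symm.trans e2.symm).trans e1
  rw [LinearEquiv.finrank_eq e4, Module.finrank_pi_fintype]
  simp [mul_comm]
end

section
/- Let X ⊂ ℂ³ be the hypersurface defined by φ(x,y,z) = x³ + x²y² + y⁷ + z², and f₁(x,y,z) = y + z², f₂(x,y,z) = x² + xy + y². Then μ(f₁|_X) := dim_ℂ O₃/(⟨φ⟩ + J(φ,f₁)) = 13 and μ(f₂|_X) := dim_ℂ O₃/(⟨φ⟩ + J(φ,f₂)) = 18, where J(φ,f_i) is the ideal of 2×2 minors of the Jacobian matrix of (φ, f_i) : ℂ³ → ℂ². -/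
open MvPowerSeries

/-- The ideal of `2×2` minors of the Jacobian matrix of `(g,h) : ℂ³ → ℂ²`. -/
noncomputable def J2 (g h : MvPowerSeries (Fin 3) ℂ) :
    Ideal (MvPowerSeries (Fin 3) ℂ) :=
  Ideal.span { pd 0 g * pd 1 h - pd 1 g * pd 0 h,
               pd 0 g * pd 2 h - pd 2 g * pd 0 h,
               pd 1 g * pd 2 h - pd 2 g * pd 1 h }


noncomputable def ee (a b c : ℕ) : Fin 3 →₀ ℕ :=
  Finsupp.single 0 a + Finsupp.single 1 b + Finsupp.single 2 c

lemma ee_0 (a b c : ℕ) : ee a b c 0 = a := by simp [ee]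
lemma ee_1 (a b c : ℕ) : ee a b c 1 = b := by simp [ee]
lemma ee_2 (a b c : ℕ) : ee a b c 2 = c := by simp [ee]

lemma eq_iff3 (m n : Fin 3 →₀ ℕ) : m = n ↔ m 0 = n 0 ∧ m 1 = n 1 ∧ m 2 = n 2 := by
  rw [Finsupp.ext_iff]; simp [Fin.forall_fin_succ]

noncomputable def mo (a b c : ℕ) : MvPowerSeries (Fin 3) ℂ := monomial (ee a b c) 1

lemma mo_eq (a b c : ℕ) : mo a b c = X 0 ^ a * X 1 ^ b * X 2 ^ c := by
  simp only [mo, X_pow_eq, monomial_mul_monomial, ee, mul_one]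

lemma coeff_mo (a b c i j k : ℕ) :
    coeff (ee a b c) (mo i j k) = if a = i ∧ b = j ∧ c = k then 1 else 0 := by
  classical
  rw [mo, coeff_monomial]
  simp only [eq_iff3, ee_0, ee_1, ee_2]

lemma coeff_mul_mo (r : MvPowerSeries (Fin 3) ℂ) (a b c i j k : ℕ) :
    coeff (ee a b c) (r * mo i j k) =
      if i ≤ a ∧ j ≤ b ∧ k ≤ c then coeff (ee (a - i) (b - j) (c - k)) r else 0 := by
  classical
  rw [mo, coeff_mul_monomial]
  have h1 : (ee i j k ≤ ee a b c) ↔ (i ≤ a ∧ j ≤ b ∧ k ≤ c) := by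
    rw [Finsupp.le_def]; simp [Fin.forall_fin_succ, ee_0, ee_1, ee_2]
  have h2 : ee a b c - ee i j k = ee (a - i) (b - j) (c - k) := by
    rw [eq_iff3]; simp [ee_0, ee_1, ee_2]
  simp only [h1, h2, mul_one]

lemma pd_add' (i : Fin 3) (f g : MvPowerSeries (Fin 3) ℂ) : pd i (f + g) = pd i f + pd i g := by
  funext m
  change _ * (f _ + g _) = _ * f _ + _ * g _
  ring

lemma coeff_pd (i : Fin 3) (f : MvPowerSeries (Fin 3) ℂ) (m) :
    coeff m (pd i f) = ((m i : ℂ) + 1) * coeff (m + Finsupp.single i 1) f := rfl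

lemma nat_mul_eq (n : ℕ) (f : MvPowerSeries (Fin 3) ℂ) :
    (n : MvPowerSeries (Fin 3) ℂ) * f = (n : ℂ) • f := by
  rw [Algebra.smul_def, map_natCast]

lemma pd0_mo (a b c : ℕ) : pd 0 (mo a b c) = (a : MvPowerSeries (Fin 3) ℂ) * mo (a - 1) b c := by
  classical
  rw [nat_mul_eq]
  ext m
  rw [coeff_pd, map_smul, mo, mo, coeff_monomial, coeff_monomial]
  simp only [eq_iff3, ee_0, ee_1, ee_2, Finsupp.add_apply]
  rcases a with _ | a
  · simp
  · by_cases h : m 0 = a <;> simp [h]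

lemma pd1_mo (a b c : ℕ) : pd 1 (mo a b c) = (b : MvPowerSeries (Fin 3) ℂ) * mo a (b - 1) c := by
  classical
  rw [nat_mul_eq]
  ext m
  rw [coeff_pd, map_smul, mo, mo, coeff_monomial, coeff_monomial]
  simp only [eq_iff3, ee_0, ee_1, ee_2, Finsupp.add_apply]
  rcases b with _ | a
  · simp
  · by_cases h : m 1 = a <;> simp [h]

lemma pd2_mo (a b c : ℕ) : pd 2 (mo a b c) = (c : MvPowerSeries (Fin 3) ℂ) * mo a b (c - 1) := by
  classical
  rw [nat_mul_eq]
  ext m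
  rw [coeff_pd, map_smul, mo, mo, coeff_monomial, coeff_monomial]
  simp only [eq_iff3, ee_0, ee_1, ee_2, Finsupp.add_apply]
  rcases c with _ | a
  · simp
  · by_cases h : m 2 = a <;> simp [h]

def ofFun (G : (Fin 3 →₀ ℕ) → ℂ) : MvPowerSeries (Fin 3) ℂ := G

lemma decomp (f : MvPowerSeries (Fin 3) ℂ) :
    ∃ (t : ℂ) (a b c : MvPowerSeries (Fin 3) ℂ), f = t • 1 + X 0 * a + X 1 * b + X 2 * c := by
  classical
  refine ⟨coeff 0 f, ofFun fun m => coeff (m + Finsupp.single 0 1) f,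
    ofFun fun m => if m 0 = 0 then coeff (m + Finsupp.single 1 1) f else 0,
    ofFun fun m => if m 0 = 0 ∧ m 1 = 0 then coeff (m + Finsupp.single 2 1) f else 0, ?_⟩
  have key : ∀ (m : Fin 3 →₀ ℕ) (i : Fin 3) (g : (Fin 3 →₀ ℕ) → ℂ),
      coeff m (X i * ofFun g) = if m i = 0 then 0 else g (m - Finsupp.single i 1) := by
    intro m i g
    rw [X_def, coeff_monomial_mul, one_mul]
    have : Finsupp.single i 1 ≤ m ↔ ¬ m i = 0 := by
      rw [Finsupp.single_le_iff]; omega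
    simp only [this, ite_not]
    rfl
  have sub : ∀ (m : Fin 3 →₀ ℕ) (i : Fin 3), m i ≠ 0 →
      m - Finsupp.single i 1 + Finsupp.single i 1 = m := by
    intro m i h
    apply tsub_add_cancel_of_le
    rw [Finsupp.single_le_iff]; omega
  ext m
  rw [map_add, map_add, map_add, key, key, key, map_smul, coeff_one, smul_eq_mul]
  by_cases h0 : m 0 = 0
  · by_cases h1 : m 1 = 0
    · by_cases h2 : m 2 = 0
      · have : m = 0 := by rw [eq_iff3]; simp [h0, h1, h2]
        subst this
        simp
      · have : m ≠ 0 := by rintro rfl; simp at h2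
        simp [h0, h1, h2, this, sub]
    · have : m ≠ 0 := by rintro rfl; simp at h1
      simp [h0, h1, this, sub]
  · have : m ≠ 0 := by rintro rfl; simp at h0
    simp [h0, this, sub]

lemma span_top (I : Ideal (MvPowerSeries (Fin 3) ℂ))
    (S : Submodule ℂ (MvPowerSeries (Fin 3) ℂ ⧸ I)) (h1 : 1 ∈ S)
    (hX : ∀ i, ∀ a ∈ S, Ideal.Quotient.mk I (X i) * a ∈ S)
    (hn : ∀ i, IsNilpotent (Ideal.Quotient.mk I (X i))) : ∀ q, q ∈ S := by
  set M : Ideal (MvPowerSeries (Fin 3) ℂ) := Ideal.span (Set.range X) with hM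
  have hMI : ∃ n, M ^ n ≤ I := by
    apply Ideal.exists_pow_le_of_le_radical_of_fg
    · rw [hM, Ideal.span_le]
      rintro _ ⟨i, rfl⟩
      obtain ⟨n, h⟩ := hn i
      refine ⟨n, ?_⟩
      rwa [← map_pow, Ideal.Quotient.eq_zero_iff_mem] at h
    · exact Submodule.fg_span (Set.finite_range _)
  have hXM : ∀ i, (X i : MvPowerSeries (Fin 3) ℂ) ∈ M := fun i => Ideal.subset_span ⟨i, rfl⟩
  have step : ∀ n, ∀ f : MvPowerSeries (Fin 3) ℂ, ∃ g ∈ M ^ n, Ideal.Quotient.mk I (f - g) ∈ S := by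
    intro n
    induction n with
    | zero => intro f; exact ⟨f, by simp, by simp⟩
    | succ n ih =>
      intro f
      obtain ⟨t, a, b, c, hf⟩ := decomp f
      obtain ⟨a', ha, ha'⟩ := ih a
      obtain ⟨b', hb, hb'⟩ := ih b
      obtain ⟨c', hc, hc'⟩ := ih c
      refine ⟨X 0 * a' + X 1 * b' + X 2 * c', ?_, ?_⟩
      · rw [pow_succ']
        exact add_mem (add_mem (Ideal.mul_mem_mul (hXM 0) ha) (Ideal.mul_mem_mul (hXM 1) hb))
          (Ideal.mul_mem_mul (hXM 2) hc)
      · have : f - (X 0 * a' + X 1 * b' + X 2 * c') =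
          t • 1 + X 0 * (a - a') + X 1 * (b - b') + X 2 * (c - c') := by rw [hf]; ring
        rw [this, map_add, map_add, map_add, map_mul, map_mul, map_mul]
        refine add_mem (add_mem (add_mem ?_ (hX _ _ ha')) (hX _ _ hb')) (hX _ _ hc')
        exact S.smul_mem t h1
  obtain ⟨n, hn⟩ := hMI
  intro q
  obtain ⟨f, rfl⟩ := Ideal.Quotient.mk_surjective q
  obtain ⟨g, hg, h⟩ := step n f
  rwa [map_sub, Ideal.Quotient.eq_zero_iff_mem.2 (hn hg), sub_zero] at h

lemma finrank_of (I : Ideal (MvPowerSeries (Fin 3) ℂ)) (n : ℕ)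
    (b : Fin n → MvPowerSeries (Fin 3) ℂ)
    (L : MvPowerSeries (Fin 3) ℂ →ₗ[ℂ] (Fin n → ℂ)) (hL : ∀ f ∈ I, L f = 0)
    (hb : ∀ i, L (b i) = Pi.single i 1)
    (hspan : ∀ q, q ∈ Submodule.span ℂ (Set.range fun i => Ideal.Quotient.mk I (b i))) :
    Module.finrank ℂ (MvPowerSeries (Fin 3) ℂ ⧸ I) = n := by
  have li : LinearIndependent ℂ (fun i => Ideal.Quotient.mk I (b i)) := by
    rw [Fintype.linearIndependent_iff]
    intro g hg i
    have h1 : (∑ i, g i • b i) ∈ I := by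
      rw [← Ideal.Quotient.eq_zero_iff_mem, map_sum, ← hg]
      rfl
    have h2 := hL _ h1
    rw [map_sum] at h2
    have h3 := congrFun h2 i
    simpa [hb, Pi.single_apply] using h3
  have B := Module.Basis.mk li (fun q _ => hspan q)
  rw [Module.finrank_eq_card_basis B, Fintype.card_fin]

def annK {n : ℕ} (L : MvPowerSeries (Fin 3) ℂ →ₗ[ℂ] (Fin n → ℂ)) :
    Ideal (MvPowerSeries (Fin 3) ℂ) where
  carrier := {f | ∀ r, L (r * f) = 0}
  add_mem' := by
    intro a b ha hb r
    rw [mul_add, map_add, ha, hb, add_zero]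
  zero_mem' := by intro r; simp
  smul_mem' := by
    intro c f hf r
    rw [smul_eq_mul, ← mul_assoc]
    exact hf _

lemma isUnit_mk (I : Ideal (MvPowerSeries (Fin 3) ℂ)) (f : MvPowerSeries (Fin 3) ℂ)
    (h : constantCoeff f ≠ 0) : IsUnit (Ideal.Quotient.mk I f) :=
  (isUnit_iff_constantCoeff.2 (isUnit_iff_ne_zero.2 h)).map _

lemma kdiv_mem {Q : Type*} [CommRing Q] [Algebra ℂ Q] (S : Submodule ℂ Q) (k : ℕ) (hk : k ≠ 0)
    {a : Q} (h : (k : Q) * a ∈ S) : a ∈ S := by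
  have h2 := S.smul_mem ((k : ℂ)⁻¹) h
  have h3 : (k : Q) * a = (k : ℂ) • a := by
    rw [Algebra.smul_def, map_natCast]
  rwa [h3, smul_smul, inv_mul_cancel₀ (Nat.cast_ne_zero.2 hk), one_smul] at h2

lemma imul {Q : Type*} [CommRing Q] [Algebra ℂ Q] (S : Submodule ℂ Q) (k : ℤ)
    {a : Q} (h : a ∈ S) : (k : Q) * a ∈ S := by
  have h3 : (k : Q) * a = (k : ℂ) • a := by
    rw [Algebra.smul_def, map_intCast]
  rw [h3]
  exact S.smul_mem _ h

lemma phi_mo : (X 0 ^ 3 + X 0 ^ 2 * X 1 ^ 2 + X 1 ^ 7 + X 2 ^ 2 : MvPowerSeries (Fin 3) ℂ) =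
    mo 3 0 0 + mo 2 2 0 + mo 0 7 0 + mo 0 0 2 := by
  simp only [mo_eq]; ring

lemma f1_mo : (X 1 + X 2 ^ 2 : MvPowerSeries (Fin 3) ℂ) = mo 0 1 0 + mo 0 0 2 := by
  simp only [mo_eq]; ring

lemma f2_mo : (X 0 ^ 2 + X 0 * X 1 + X 1 ^ 2 : MvPowerSeries (Fin 3) ℂ) =
    mo 2 0 0 + mo 1 1 0 + mo 0 2 0 := by
  simp only [mo_eq]; ring

lemma J2_1 : Ideal.span {(X 0 ^ 3 + X 0 ^ 2 * X 1 ^ 2 + X 1 ^ 7 + X 2 ^ 2 : MvPowerSeries (Fin 3) ℂ)}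
      ⊔ J2 (X 0 ^ 3 + X 0 ^ 2 * X 1 ^ 2 + X 1 ^ 7 + X 2 ^ 2) (X 1 + X 2 ^ 2) =
    Ideal.span {(X 0 ^ 3 + X 0 ^ 2 * X 1 ^ 2 + X 1 ^ 7 + X 2 ^ 2 : MvPowerSeries (Fin 3) ℂ),
      3 * X 0 ^ 2 + 2 * X 0 * X 1 ^ 2,
      (3 * X 0 ^ 2 + 2 * X 0 * X 1 ^ 2) * (2 * X 2),
      (2 * X 0 ^ 2 * X 1 + 7 * X 1 ^ 6) * (2 * X 2) - 2 * X 2} := by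
  rw [J2, ← Ideal.span_union, Set.singleton_union, phi_mo, f1_mo]
  simp only [pd_add', pd0_mo, pd1_mo, pd2_mo]
  simp only [mo_eq]
  congr 3
  · push_cast; ring
  congr 1
  · push_cast; ring
  · push_cast; ring_nf

lemma J2_2 : Ideal.span {(X 0 ^ 3 + X 0 ^ 2 * X 1 ^ 2 + X 1 ^ 7 + X 2 ^ 2 : MvPowerSeries (Fin 3) ℂ)}
      ⊔ J2 (X 0 ^ 3 + X 0 ^ 2 * X 1 ^ 2 + X 1 ^ 7 + X 2 ^ 2) (X 0 ^ 2 + X 0 * X 1 + X 1 ^ 2) =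
    Ideal.span {(X 0 ^ 3 + X 0 ^ 2 * X 1 ^ 2 + X 1 ^ 7 + X 2 ^ 2 : MvPowerSeries (Fin 3) ℂ),
      3 * X 0 ^ 3 + 6 * X 0 ^ 2 * X 1 - 4 * X 0 ^ 3 * X 1 + 4 * X 0 * X 1 ^ 3 - 14 * X 0 * X 1 ^ 6
        - 7 * X 1 ^ 7,
      -(2 * X 2 * (2 * X 0 + X 1)),
      -(2 * X 2 * (X 0 + 2 * X 1))} := by
  rw [J2, ← Ideal.span_union, Set.singleton_union, phi_mo, f2_mo]
  simp only [pd_add', pd0_mo, pd1_mo, pd2_mo]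
  simp only [mo_eq]
  congr 3
  · push_cast; ring
  congr 1
  · push_cast; ring
  · push_cast; ring_nf

noncomputable def L1 : MvPowerSeries (Fin 3) ℂ →ₗ[ℂ] (Fin 13 → ℂ) :=
  LinearMap.pi ![
    coeff (ee 0 0 0),
    coeff (ee 0 1 0),
    coeff (ee 0 2 0),
    coeff (ee 0 3 0),
    coeff (ee 0 4 0),
    coeff (ee 0 5 0),
    coeff (ee 0 6 0),
    coeff (ee 1 0 0),
    coeff (ee 1 1 0),
    coeff (ee 1 2 0) + (-2/3 : ℂ) • coeff (ee 2 0 0),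
    coeff (ee 1 3 0) + (-2/3 : ℂ) • coeff (ee 2 1 0),
    coeff (ee 1 4 0) + (-2/3 : ℂ) • coeff (ee 2 2 0) + (4/9 : ℂ) • coeff (ee 3 0 0) + (2/9 : ℂ) • coeff (ee 0 7 0),
    coeff (ee 1 5 0) + (-2/3 : ℂ) • coeff (ee 2 3 0) + (4/9 : ℂ) • coeff (ee 3 1 0) + (2/9 : ℂ) • coeff (ee 0 8 0)]

noncomputable def b1 : Fin 13 → MvPowerSeries (Fin 3) ℂ :=
  ![mo 0 0 0, mo 0 1 0, mo 0 2 0, mo 0 3 0, mo 0 4 0, mo 0 5 0, mo 0 6 0, mo 1 0 0, mo 1 1 0, mo 1 2 0, mo 1 3 0, mo 1 4 0, mo 1 5 0]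

lemma L1_apply (f : MvPowerSeries (Fin 3) ℂ) : L1 f = ![
    coeff (ee 0 0 0) f,
    coeff (ee 0 1 0) f,
    coeff (ee 0 2 0) f,
    coeff (ee 0 3 0) f,
    coeff (ee 0 4 0) f,
    coeff (ee 0 5 0) f,
    coeff (ee 0 6 0) f,
    coeff (ee 1 0 0) f,
    coeff (ee 1 1 0) f,
    coeff (ee 1 2 0) f + (-2/3 : ℂ) * coeff (ee 2 0 0) f,
    coeff (ee 1 3 0) f + (-2/3 : ℂ) * coeff (ee 2 1 0) f,
    coeff (ee 1 4 0) f + (-2/3 : ℂ) * coeff (ee 2 2 0) f + (4/9 : ℂ) * coeff (ee 3 0 0) f + (2/9 : ℂ) * coeff (ee 0 7 0) f,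
    coeff (ee 1 5 0) f + (-2/3 : ℂ) * coeff (ee 2 3 0) f + (4/9 : ℂ) * coeff (ee 3 1 0) f + (2/9 : ℂ) * coeff (ee 0 8 0) f] := by
  funext i
  fin_cases i <;> rfl

set_option maxHeartbeats 4000000 in
lemma hb1 : ∀ i, L1 (b1 i) = Pi.single i 1 := by
  intro i
  fin_cases i <;> rw [L1_apply] <;> simp [b1, coeff_mo] <;> funext j <;> fin_cases j <;> rfl

set_option maxHeartbeats 1000000 in
lemma ann1_z : ((1 : ℂ) • mo 0 0 1) ∈ annK L1 := by
  intro r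
  have h : r * ((1 : ℂ) • mo 0 0 1) =
      (1 : ℂ) • (r * mo 0 0 1) := by
    simp only [mul_add, mul_smul_comm]
  rw [h]
  funext i
  fin_cases i <;> simp [L1, coeff_mul_mo] <;> ring

set_option maxHeartbeats 1000000 in
lemma ann1_g : ((3 : ℂ) • mo 2 0 0 + (2 : ℂ) • mo 1 2 0) ∈ annK L1 := by
  intro r
  have h : r * ((3 : ℂ) • mo 2 0 0 + (2 : ℂ) • mo 1 2 0) =
      (3 : ℂ) • (r * mo 2 0 0) + (2 : ℂ) • (r * mo 1 2 0) := by
    simp only [mul_add, mul_smul_comm]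
  rw [h]
  funext i
  fin_cases i <;> simp [L1, coeff_mul_mo] <;> ring

set_option maxHeartbeats 1000000 in
lemma ann1_f : ((1 : ℂ) • mo 3 0 0 + (1 : ℂ) • mo 2 2 0 + (1 : ℂ) • mo 0 7 0 + (1 : ℂ) • mo 0 0 2) ∈ annK L1 := by
  intro r
  have h : r * ((1 : ℂ) • mo 3 0 0 + (1 : ℂ) • mo 2 2 0 + (1 : ℂ) • mo 0 7 0 + (1 : ℂ) • mo 0 0 2) =
      (1 : ℂ) • (r * mo 3 0 0) + (1 : ℂ) • (r * mo 2 2 0) + (1 : ℂ) • (r * mo 0 7 0) + (1 : ℂ) • (r * mo 0 0 2) := by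
    simp only [mul_add, mul_smul_comm]
  rw [h]
  funext i
  fin_cases i <;> simp [L1, coeff_mul_mo] <;> ring

noncomputable def L2 : MvPowerSeries (Fin 3) ℂ →ₗ[ℂ] (Fin 18 → ℂ) :=
  LinearMap.pi ![
    coeff (ee 0 0 0),
    coeff (ee 1 0 0),
    coeff (ee 2 0 0),
    coeff (ee 3 0 0) + (-1/2 : ℂ) • coeff (ee 2 1 0) + (-1 : ℂ) • coeff (ee 0 0 2),
    coeff (ee 0 1 0),
    coeff (ee 0 2 0),
    coeff (ee 0 3 0),
    coeff (ee 0 4 0),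
    coeff (ee 0 5 0),
    coeff (ee 0 6 0),
    coeff (ee 0 7 0) + (7/6 : ℂ) • coeff (ee 2 1 0) + (-1 : ℂ) • coeff (ee 0 0 2),
    coeff (ee 0 8 0) + (4/3 : ℂ) • coeff (ee 2 1 0) + (2 : ℂ) • coeff (ee 3 1 0) + (1/6 : ℂ) • coeff (ee 2 2 0) + (-3 : ℂ) • coeff (ee 2 3 0) + (9/2 : ℂ) • coeff (ee 1 5 0) + (-1/6 : ℂ) • coeff (ee 0 0 2),
    coeff (ee 0 9 0) + (25/2 : ℂ) • coeff (ee 2 1 0) + (-2 : ℂ) • coeff (ee 4 0 0) + (3 : ℂ) • coeff (ee 3 1 0) + (-1/6 : ℂ) • coeff (ee 2 2 0) + (2 : ℂ) • coeff (ee 3 2 0) + (-3 : ℂ) • coeff (ee 2 3 0) + (-3 : ℂ) • coeff (ee 2 4 0) + (19/4 : ℂ) • coeff (ee 1 5 0) + (9/2 : ℂ) • coeff (ee 1 6 0) + (1/6 : ℂ) • coeff (ee 0 0 2),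
    coeff (ee 1 1 0),
    coeff (ee 1 2 0),
    coeff (ee 1 3 0) + (-2/3 : ℂ) • coeff (ee 2 1 0),
    coeff (ee 1 4 0) + (-2/3 : ℂ) • coeff (ee 2 2 0) + (2/3 : ℂ) • coeff (ee 0 0 2),
    coeff (ee 0 0 1)]

noncomputable def b2 : Fin 18 → MvPowerSeries (Fin 3) ℂ :=
  ![mo 0 0 0, mo 1 0 0, mo 2 0 0, mo 3 0 0, mo 0 1 0, mo 0 2 0, mo 0 3 0, mo 0 4 0, mo 0 5 0, mo 0 6 0, mo 0 7 0, mo 0 8 0, mo 0 9 0, mo 1 1 0, mo 1 2 0, mo 1 3 0, mo 1 4 0, mo 0 0 1]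

lemma L2_apply (f : MvPowerSeries (Fin 3) ℂ) : L2 f = ![
    coeff (ee 0 0 0) f,
    coeff (ee 1 0 0) f,
    coeff (ee 2 0 0) f,
    coeff (ee 3 0 0) f + (-1/2 : ℂ) * coeff (ee 2 1 0) f + (-1 : ℂ) * coeff (ee 0 0 2) f,
    coeff (ee 0 1 0) f,
    coeff (ee 0 2 0) f,
    coeff (ee 0 3 0) f,
    coeff (ee 0 4 0) f,
    coeff (ee 0 5 0) f,
    coeff (ee 0 6 0) f,
    coeff (ee 0 7 0) f + (7/6 : ℂ) * coeff (ee 2 1 0) f + (-1 : ℂ) * coeff (ee 0 0 2) f,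
    coeff (ee 0 8 0) f + (4/3 : ℂ) * coeff (ee 2 1 0) f + (2 : ℂ) * coeff (ee 3 1 0) f + (1/6 : ℂ) * coeff (ee 2 2 0) f + (-3 : ℂ) * coeff (ee 2 3 0) f + (9/2 : ℂ) * coeff (ee 1 5 0) f + (-1/6 : ℂ) * coeff (ee 0 0 2) f,
    coeff (ee 0 9 0) f + (25/2 : ℂ) * coeff (ee 2 1 0) f + (-2 : ℂ) * coeff (ee 4 0 0) f + (3 : ℂ) * coeff (ee 3 1 0) f + (-1/6 : ℂ) * coeff (ee 2 2 0) f + (2 : ℂ) * coeff (ee 3 2 0) f + (-3 : ℂ) * coeff (ee 2 3 0) f + (-3 : ℂ) * coeff (ee 2 4 0) f + (19/4 : ℂ) * coeff (ee 1 5 0) f + (9/2 : ℂ) * coeff (ee 1 6 0) f + (1/6 : ℂ) * coeff (ee 0 0 2) f,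
    coeff (ee 1 1 0) f,
    coeff (ee 1 2 0) f,
    coeff (ee 1 3 0) f + (-2/3 : ℂ) * coeff (ee 2 1 0) f,
    coeff (ee 1 4 0) f + (-2/3 : ℂ) * coeff (ee 2 2 0) f + (2/3 : ℂ) * coeff (ee 0 0 2) f,
    coeff (ee 0 0 1) f] := by
  funext i
  fin_cases i <;> rfl

set_option maxHeartbeats 4000000 in
lemma hb2 : ∀ i, L2 (b2 i) = Pi.single i 1 := by
  intro i
  fin_cases i <;> rw [L2_apply] <;> simp [b2, coeff_mo] <;> funext j <;> fin_cases j <;> rfl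

set_option maxHeartbeats 1000000 in
lemma ann2_zx : ((1 : ℂ) • mo 1 0 1) ∈ annK L2 := by
  intro r
  have h : r * ((1 : ℂ) • mo 1 0 1) =
      (1 : ℂ) • (r * mo 1 0 1) := by
    simp only [mul_add, mul_smul_comm]
  rw [h]
  funext i
  fin_cases i <;> simp [L2, coeff_mul_mo] <;> ring

set_option maxHeartbeats 1000000 in
lemma ann2_zy : ((1 : ℂ) • mo 0 1 1) ∈ annK L2 := by
  intro r
  have h : r * ((1 : ℂ) • mo 0 1 1) =
      (1 : ℂ) • (r * mo 0 1 1) := by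
    simp only [mul_add, mul_smul_comm]
  rw [h]
  funext i
  fin_cases i <;> simp [L2, coeff_mul_mo] <;> ring

set_option maxHeartbeats 1000000 in
lemma ann2_h : ((3 : ℂ) • mo 3 0 0 + (6 : ℂ) • mo 2 1 0 + (-4 : ℂ) • mo 3 1 0 + (4 : ℂ) • mo 1 3 0 + (-14 : ℂ) • mo 1 6 0 + (-7 : ℂ) • mo 0 7 0) ∈ annK L2 := by
  intro r
  have h : r * ((3 : ℂ) • mo 3 0 0 + (6 : ℂ) • mo 2 1 0 + (-4 : ℂ) • mo 3 1 0 + (4 : ℂ) • mo 1 3 0 + (-14 : ℂ) • mo 1 6 0 + (-7 : ℂ) • mo 0 7 0) =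
      (3 : ℂ) • (r * mo 3 0 0) + (6 : ℂ) • (r * mo 2 1 0) + (-4 : ℂ) • (r * mo 3 1 0) + (4 : ℂ) • (r * mo 1 3 0) + (-14 : ℂ) • (r * mo 1 6 0) + (-7 : ℂ) • (r * mo 0 7 0) := by
    simp only [mul_add, mul_smul_comm]
  rw [h]
  funext i
  fin_cases i <;> simp [L2, coeff_mul_mo] <;> ring

set_option maxHeartbeats 1000000 in
lemma ann2_f : ((1 : ℂ) • mo 3 0 0 + (1 : ℂ) • mo 2 2 0 + (1 : ℂ) • mo 0 7 0 + (1 : ℂ) • mo 0 0 2) ∈ annK L2 := by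
  intro r
  have h : r * ((1 : ℂ) • mo 3 0 0 + (1 : ℂ) • mo 2 2 0 + (1 : ℂ) • mo 0 7 0 + (1 : ℂ) • mo 0 0 2) =
      (1 : ℂ) • (r * mo 3 0 0) + (1 : ℂ) • (r * mo 2 2 0) + (1 : ℂ) • (r * mo 0 7 0) + (1 : ℂ) • (r * mo 0 0 2) := by
    simp only [mul_add, mul_smul_comm]
  rw [h]
  funext i
  fin_cases i <;> simp [L2, coeff_mul_mo] <;> ring

lemma cert_y10 {Q : Type*} [CommRing Q] (x y : Q)
    (hx : x * (x ^ 3 + x ^ 2 * y ^ 2 + y ^ 7) = 0)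
    (hy : y * (x ^ 3 + x ^ 2 * y ^ 2 + y ^ 7) = 0)
    (hh : 3 * x ^ 3 + 6 * x ^ 2 * y - 4 * x ^ 3 * y + 4 * x * y ^ 3 - 14 * x * y ^ 6 - 7 * y ^ 7 = 0) :
    (5392 + (-697266 * x ^ 2 - 14232 * x - 494098 * x * y - 30374 * x * y ^ 2 - 32536 * x * y ^ 3 + 18128 * y ^ 4 - 17209 * y ^ 3 - 296996 * y ^ 2 - 13988 * y)) * y ^ 10 = 0 := by
  linear_combination (52376 * x * y ^ 2 + 4044 * x - 75576 * y ^ 2 + 8088 * y + 201116 * y ^ 5 - 175101 * y ^ 4 + 31478 * y ^ 3 - 29236 * x * y - 32536 * y ^ 6 - 9296 * x ^ 2 * y + 6972 * x ^ 2 - 2656 * x * y ^ 3) * hx + (-311150 * y ^ 4 - 13988 * y ^ 3 + 5392 * y ^ 2 + 98536 * y ^ 5 + 18128 * y ^ 6) * hy + (49615 * x * y ^ 4 - 1348 * x ^ 2 + 12596 * x ^ 2 * y - 1348 * x * y ^ 2 + 6530 * x * y ^ 3 + 16535 * y ^ 6 - 2022 * y ^ 5 - 2324 * x ^ 3 - 2988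 * x ^ 2 * y ^ 2) * hh

lemma cert_1_5 {Q : Type*} [CommRing Q] (x y : Q)
    (hx : x * (x ^ 3 + x ^ 2 * y ^ 2 + y ^ 7) = 0)
    (hy : y * (x ^ 3 + x ^ 2 * y ^ 2 + y ^ 7) = 0)
    (hh : 3 * x ^ 3 + 6 * x ^ 2 * y - 4 * x ^ 3 * y + 4 * x * y ^ 3 - 14 * x * y ^ 6 - 7 * y ^ 7 = 0)
    (h10 : y ^ 10 = 0) :
    ((529120 : ℕ) : Q) * (x * y ^ 5) = ((2381040 : ℤ) : Q) * (y ^ 8) + ((2513320 : ℤ) : Q) * (y ^ 9) := by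
  push_cast
  linear_combination (12385998 * y ^ 4 - 14194888 * x * y ^ 2 + 1795758 * x + 17106978 * y ^ 2 + 3988356 * y + 25583953 * x * y - 1190520 * 1 + 27124021 * y ^ 3 - 16594488 * y ^ 5 - 36527932 * y ^ 6 - 10436552 * x ^ 2 * y + 7827414 * x ^ 2 - 2981872 * x * y ^ 3) * hx + (-67006414 * y ^ 6 - 1587360 * y - 2381040 * 1 + 19146260 * y ^ 4 + 21084754 * y ^ 3 - 15728016 * y ^ 2 - 20124758 * y ^ 5) * hy + (-4107823 * x ^ 2 * y - 598586 * x ^ 2 + 2443854 * x * y ^ 2 + 396840 * x * y + 396840 * x - 4122790 * x * y ^ 3 + 132280 * y ^ 2 + 992100 * y ^ 4 + 160361 * y ^ 5 - 4894090 * x * y ^ 4 - 2609138 * x ^ 3 - 3354606 * x ^ 2 * y ^ 2) * hh + (-44399574 * x * y - 42094151 * x - 65535388 * x ^ 2 + 16594488 * x * y ^ 2 + 36527932 * x * y ^ 3 + 67006414 * y ^ 4 + 20124758 * y ^ 3 - 18023733 * y ^ 2 - 14140054 * y + 15728016 * 1) * h10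

lemma cert_2_4 {Q : Type*} [CommRing Q] (x y : Q)
    (hx : x * (x ^ 3 + x ^ 2 * y ^ 2 + y ^ 7) = 0)
    (hy : y * (x ^ 3 + x ^ 2 * y ^ 2 + y ^ 7) = 0)
    (hh : 3 * x ^ 3 + 6 * x ^ 2 * y - 4 * x ^ 3 * y + 4 * x * y ^ 3 - 14 * x * y ^ 6 - 7 * y ^ 7 = 0)
    (h10 : y ^ 10 = 0) :
    ((264560 : ℕ) : Q) * (x ^ 2 * y ^ 4) = ((-793680 : ℤ) : Q) * (y ^ 9) := by
  push_cast
  linear_combination (-910116 * y + 135842 * y ^ 2 - 3539713 * x * y - 653478 * x - 4892981 * y ^ 3 - 681592 * x * y ^ 2 + 688728 * y ^ 5 - 696358 * y ^ 4 + 10373692 * y ^ 6 + 2963912 * x ^ 2 * y - 2222934 * x ^ 2 + 846832 * x * y ^ 3) * hx + (793680 * y + 250046 * y ^ 3 - 1209220 * y ^ 4 - 77624 * y ^ 2 + 3730078 * y ^ 5 + 6558414 * y ^ 6) * hy + (-132280 * x * y + 217826 * x ^ 2 + 19406 * x * y ^ 2 - 3961 * y ^ 5 + 383890 * x * y ^ 4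 - 11617 * x ^ 2 * y - 56570 * x * y ^ 3 + 740978 * x ^ 3 + 952686 * x ^ 2 * y ^ 2) * hh + (4496991 * x + 3328134 * x * y + 4527628 * x ^ 2 - 688728 * x * y ^ 2 - 10373692 * x * y ^ 3 - 6558414 * y ^ 4 - 3730078 * y ^ 3 + 1181493 * y ^ 2 - 250046 * y + 77624 * 1) * h10

lemma cert_2_3 {Q : Type*} [CommRing Q] (x y : Q)
    (hx : x * (x ^ 3 + x ^ 2 * y ^ 2 + y ^ 7) = 0)
    (hy : y * (x ^ 3 + x ^ 2 * y ^ 2 + y ^ 7) = 0)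
    (hh : 3 * x ^ 3 + 6 * x ^ 2 * y - 4 * x ^ 3 * y + 4 * x * y ^ 3 - 14 * x * y ^ 6 - 7 * y ^ 7 = 0)
    (h10 : y ^ 10 = 0) :
    ((529120 : ℕ) : Q) * (x ^ 2 * y ^ 3) = ((-1587360 : ℤ) : Q) * (y ^ 8) + ((-1587360 : ℤ) : Q) * (y ^ 9) := by
  push_cast
  linear_combination (-1582268 * y + 793680 * 1 - 12352074 * y ^ 2 - 21332839 * x * y - 857274 * x - 20548283 * y ^ 3 + 9274584 * x * y ^ 2 + 16294184 * y ^ 5 - 13558714 * y ^ 4 + 32708676 * y ^ 6 + 9345336 * x ^ 2 * y - 7009002 * x ^ 2 + 2670096 * x * y ^ 3) * hx + (1587360 * y - 11849502 * y ^ 3 + 1587360 * 1 - 21662460 * y ^ 4 + 11026728 * y ^ 2 + 16363714 * y ^ 5 + 46539202 * y ^ 6) * hy + (-264560 * x - 661400 * y ^ 4 - 396840 * x * y + 285758 * x ^ 2 - 1764582 * x * y ^ 2 - 298903 * y ^ 5 + 4741070 * x * y ^ 4 + 2819289 * x ^ 2 * y + 2484770 * x * y ^ 3 + 2336334 * x ^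 3 + 3003858 * x ^ 2 * y ^ 2) * hh + (28682073 * x + 42561562 * x * y + 63704884 * x ^ 2 - 16294184 * x * y ^ 2 - 32708676 * x * y ^ 3 - 46539202 * y ^ 4 - 16363714 * y ^ 3 + 19570139 * y ^ 2 + 7219702 * y - 11026728 * 1) * h10

lemma cert_2_2 {Q : Type*} [CommRing Q] (x y : Q)
    (hx : x * (x ^ 3 + x ^ 2 * y ^ 2 + y ^ 7) = 0)
    (hy : y * (x ^ 3 + x ^ 2 * y ^ 2 + y ^ 7) = 0)
    (hh : 3 * x ^ 3 + 6 * x ^ 2 * y - 4 * x ^ 3 * y + 4 * x * y ^ 3 - 14 * x * y ^ 6 - 7 * y ^ 7 = 0)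
    (h10 : y ^ 10 = 0) :
    ((634944 : ℕ) : Q) * (x ^ 2 * y ^ 2) = ((105824 : ℤ) : Q) * (y ^ 8) + ((-105824 : ℤ) : Q) * (y ^ 9) + ((-423296 : ℤ) : Q) * (x * y ^ 4) := by
  push_cast
  linear_combination (-2381750 * y ^ 2 + 476208 * 1 + 2676444 * y - 2582993 * x * y + 1616010 * x + 3120627 * y ^ 3 + 1179304 * x * y ^ 2 + 10138520 * y ^ 5 - 10183286 * y ^ 4 - 961380 * y ^ 6 - 274680 * x ^ 2 * y + 206010 * x ^ 2 - 78480 * x * y ^ 3) * hx + (105824 * y + 634944 * 1 - 15817124 * y ^ 4 + 3529102 * y ^ 3 + 1519736 * y ^ 2 - 219730 * y ^ 5 - 6903666 * y ^ 6) * hy + (-26456 * y ^ 4 - 158736 * x - 26456 * x * y + 105824 * y - 538670 * x ^ 2 - 340250 * x * y ^ 2 - 715409 * y ^ 5 + 2515010 * x * y ^ 4 + 280111 * x ^ 2 * y - 364738 * x * y ^ 3 - 68670 * x ^ 3 - 88290 * x ^ 2 * y ^ 2) * hh + (-6044177 * x + 17772630 * x * y + 35288620 * x ^ 2 - 10138520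 * x * y ^ 2 + 961380 * x * y ^ 3 + 6903666 * y ^ 4 + 219730 * y ^ 3 + 10809261 * y ^ 2 - 3714294 * y - 1519736 * 1) * h10

lemma cert_2_1 {Q : Type*} [CommRing Q] (x y : Q)
    (hx : x * (x ^ 3 + x ^ 2 * y ^ 2 + y ^ 7) = 0)
    (hy : y * (x ^ 3 + x ^ 2 * y ^ 2 + y ^ 7) = 0)
    (hh : 3 * x ^ 3 + 6 * x ^ 2 * y - 4 * x ^ 3 * y + 4 * x * y ^ 3 - 14 * x * y ^ 6 - 7 * y ^ 7 = 0)
    (h10 : y ^ 10 = 0) :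
    ((79368 : ℕ) : Q) * (x ^ 2 * y) = ((-39684 : ℤ) : Q) * (x ^ 3) + ((92596 : ℤ) : Q) * (y ^ 7) + ((105824 : ℤ) : Q) * (y ^ 8) + ((992100 : ℤ) : Q) * (y ^ 9) + ((-52912 : ℤ) : Q) * (x * y ^ 3) := by
  push_cast
  linear_combination (1137818 * y - 79368 * 1 + 1226652 * y ^ 2 + 4499538 * x * y + 783864 * x + 5767769 * y ^ 3 - 347612 * x * y ^ 2 - 1858464 * y ^ 5 + 1598252 * y ^ 4 - 11136132 * y ^ 6 - 3181752 * x ^ 2 * y + 2386314 * x ^ 2 - 909072 * x * y ^ 3) * hx + (-105824 * 1 - 992100 * y + 1027054 * y ^ 3 + 2654748 * y ^ 4 - 727400 * y ^ 2 - 5144056 * y ^ 5 - 9698872 * y ^ 6) * hy + (13228 * 1 + 46298 * y ^ 3 + 26456 * x + 66140 * y ^ 4 + 178578 * x * y - 261288 * x ^ 2 + 82640 * x * y ^ 2 + 28057 * y ^ 5 - 691884 * x * y ^ 4 - 257354 * x ^ 2 * y - 206253 * x * y ^ 3 - 795438 * x ^ 3 - 1022706 * x ^ 2 * y ^ 2)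 * hh + (-6285580 * x - 6048642 * x * y - 8777304 * x ^ 2 + 1858464 * x * y ^ 2 + 11136132 * x * y ^ 3 + 9698872 * y ^ 4 + 5144056 * y ^ 3 - 2458349 * y ^ 2 - 564074 * y + 1051486 * 1) * h10

lemma cert_3_1 {Q : Type*} [CommRing Q] (x y : Q)
    (hx : x * (x ^ 3 + x ^ 2 * y ^ 2 + y ^ 7) = 0)
    (hy : y * (x ^ 3 + x ^ 2 * y ^ 2 + y ^ 7) = 0)
    (hh : 3 * x ^ 3 + 6 * x ^ 2 * y - 4 * x ^ 3 * y + 4 * x * y ^ 3 - 14 * x * y ^ 6 - 7 * y ^ 7 = 0)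
    (h10 : y ^ 10 = 0) :
    ((529120 : ℕ) : Q) * (x ^ 3 * y) = ((1058240 : ℤ) : Q) * (y ^ 8) + ((1587360 : ℤ) : Q) * (y ^ 9) := by
  push_cast
  linear_combination (1582268 * y - 793680 * 1 + 12352074 * y ^ 2 + 21332839 * x * y + 857274 * x + 20548283 * y ^ 3 - 9274584 * x * y ^ 2 - 16294184 * y ^ 5 + 13558714 * y ^ 4 - 32708676 * y ^ 6 - 9345336 * x ^ 2 * y + 7009002 * x ^ 2 - 2670096 * x * y ^ 3) * hx + (-1058240 * 1 - 1587360 * y + 11849502 * y ^ 3 + 21662460 * y ^ 4 - 11026728 * y ^ 2 - 16363714 * y ^ 5 - 46539202 * y ^ 6) * hy + (264560 * x + 661400 * y ^ 4 + 396840 * x * y - 285758 * x ^ 2 + 1764582 * x * y ^ 2 + 298903 * y ^ 5 - 4741070 * x * y ^ 4 - 2819289 * x ^ 2 * y - 2484770 * x * y ^ 3 - 2336334 * x ^ 3 - 3003858 * x ^ 2 * y ^ 2) * hh + (-28682073 * x - 42561562 * x * y - 63704884 * x ^ 2 + 16294184 * x * y ^ 2 + 32708676 * x * y ^ 3 + 46539202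 * y ^ 4 + 16363714 * y ^ 3 - 19570139 * y ^ 2 - 7219702 * y + 11026728 * 1) * h10

lemma cert_4_0 {Q : Type*} [CommRing Q] (x y : Q)
    (hx : x * (x ^ 3 + x ^ 2 * y ^ 2 + y ^ 7) = 0)
    (hy : y * (x ^ 3 + x ^ 2 * y ^ 2 + y ^ 7) = 0)
    (hh : 3 * x ^ 3 + 6 * x ^ 2 * y - 4 * x ^ 3 * y + 4 * x * y ^ 3 - 14 * x * y ^ 6 - 7 * y ^ 7 = 0)
    (h10 : y ^ 10 = 0) :
    ((264560 : ℕ) : Q) * (x ^ 4) = ((-529120 : ℤ) : Q) * (y ^ 9) := by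
  push_cast
  linear_combination (264560 * 1 - 1297548 * y - 801094 * y ^ 2 - 4352779 * x * y - 847194 * x - 6253843 * y ^ 3 + 296264 * x * y ^ 2 + 427304 * y ^ 5 - 131674 * y ^ 4 + 11085956 * y ^ 6 + 3167416 * x ^ 2 * y - 2375562 * x ^ 2 + 904976 * x * y ^ 3) * hx + (529120 * y - 1721182 * y ^ 3 - 360220 * y ^ 4 + 854608 * y ^ 2 + 4456834 * y ^ 5 + 10903722 * y ^ 6) * hy + (-66140 * y ^ 4 - 132280 * x * y + 282398 * x ^ 2 - 114442 * x * y ^ 2 + 92897 * y ^ 5 + 333070 * x * y ^ 4 + 243749 * x ^ 2 * y + 290950 * x * y ^ 3 + 791854 * x ^ 3 + 1018098 * x ^ 2 * y ^ 2) * hh + (7364533 * x + 3763722 * x * y + 3758004 * x ^ 2 - 427304 * x * y ^ 2 - 11085956 * x * y ^ 3 - 10903722 * y ^ 4 - 4456834 * y ^ 3 + 1010499 * y ^ 2 + 1258202 * y - 854608 * 1) * h10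

lemma mq {Q : Type*} [CommRing Q] [Algebra ℂ Q] {S : Submodule ℂ Q} {a b : Q}
    (h : a ∈ S) (e : b = a) : b ∈ S := e ▸ h

lemma kz {Q : Type*} [CommRing Q] [Algebra ℂ Q] (k : ℕ) (hk : k ≠ 0) {a : Q}
    (h : (k : Q) * a = 0) : a = 0 := by
  have : a ∈ (⊥ : Submodule ℂ Q) := kdiv_mem ⊥ k hk (by rw [h]; exact zero_mem _)
  simpa using this

lemma closure1 {Q : Type*} [CommRing Q] [Algebra ℂ Q] (x y z : Q) (b : Fin 13 → Q)
    (hb : b = ![1, y, y ^ 2, y ^ 3, y ^ 4, y ^ 5, y ^ 6, x, x * y, x * y ^ 2, x * y ^ 3, x * y ^ 4, x * y ^ 5])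
    (hz : z = 0) (hg : 3 * x ^ 2 + 2 * x * y ^ 2 = 0) (hf : x ^ 3 + x ^ 2 * y ^ 2 + y ^ 7 = 0)
    (h6 : x * y ^ 6 = 0) :
    ∀ a ∈ Submodule.span ℂ (Set.range b), x * a ∈ Submodule.span ℂ (Set.range b) ∧
      y * a ∈ Submodule.span ℂ (Set.range b) ∧ z * a ∈ Submodule.span ℂ (Set.range b) := by
  set S := Submodule.span ℂ (Set.range b) with hS
  have m : ∀ i, b i ∈ S := fun i => Submodule.subset_span ⟨i, rfl⟩
  subst hb
  have m_0_0_0 : 1 ∈ S := m 0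
  have m_0_1_0 : y ∈ S := m 1
  have m_0_2_0 : y ^ 2 ∈ S := m 2
  have m_0_3_0 : y ^ 3 ∈ S := m 3
  have m_0_4_0 : y ^ 4 ∈ S := m 4
  have m_0_5_0 : y ^ 5 ∈ S := m 5
  have m_0_6_0 : y ^ 6 ∈ S := m 6
  have m_1_0_0 : x ∈ S := m 7
  have m_1_1_0 : x * y ∈ S := m 8
  have m_1_2_0 : x * y ^ 2 ∈ S := m 9
  have m_1_3_0 : x * y ^ 3 ∈ S := m 10
  have m_1_4_0 : x * y ^ 4 ∈ S := m 11
  have m_1_5_0 : x * y ^ 5 ∈ S := m 12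
  have hxy6 : x * y ^ 6 = 0 := h6
  have m_0_7_0 : y ^ 7 ∈ S := by
    apply kdiv_mem S 9 (by norm_num)
    exact mq (imul S 2 m_1_4_0) (by push_cast; linear_combination 9 * hf - (3 * x + y ^ 2) * hg)
  have m_1_6_0 : x * y ^ 6 ∈ S := mq S.zero_mem h6
  have m_2_0_0 : x ^ 2 ∈ S := by
    apply kdiv_mem S 3 (by norm_num)
    exact mq (imul S (-2) m_1_2_0) (by push_cast; linear_combination 1 * hg)
  have m_2_1_0 : x ^ 2 * y ∈ S := by
    apply kdiv_mem S 3 (by norm_num)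
    exact mq (imul S (-2) m_1_3_0) (by push_cast; linear_combination y * hg)
  have m_2_2_0 : x ^ 2 * y ^ 2 ∈ S := by
    apply kdiv_mem S 3 (by norm_num)
    exact mq (imul S (-2) m_1_4_0) (by push_cast; linear_combination y ^ 2 * hg)
  have m_2_3_0 : x ^ 2 * y ^ 3 ∈ S := by
    apply kdiv_mem S 3 (by norm_num)
    exact mq (imul S (-2) m_1_5_0) (by push_cast; linear_combination y ^ 3 * hg)
  have m_2_4_0 : x ^ 2 * y ^ 4 ∈ S := by
    apply kdiv_mem S 3 (by norm_num)
    exact mq S.zero_mem (by push_cast; linear_combination y ^ 4 * hg - 2 * 1 * h6)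
  have m_2_5_0 : x ^ 2 * y ^ 5 ∈ S := by
    apply kdiv_mem S 3 (by norm_num)
    exact mq S.zero_mem (by push_cast; linear_combination y ^ 5 * hg - 2 * y * h6)

  intro a ha
  induction ha using Submodule.span_induction with
  | zero => simp
  | add u v _ _ hu hv =>
    simp only [mul_add]
    exact ⟨add_mem hu.1 hv.1, add_mem hu.2.1 hv.2.1, add_mem hu.2.2 hv.2.2⟩
  | smul c u _ hu =>
    simp only [mul_smul_comm]
    exact ⟨S.smul_mem c hu.1, S.smul_mem c hu.2.1, S.smul_mem c hu.2.2⟩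
  | mem u hu =>
    obtain ⟨i, rfl⟩ := hu
    fin_cases i
    · have kx : x * (1) ∈ S := mq m_1_0_0 (by ring)
      have ky : y * (1) ∈ S := mq m_0_1_0 (by ring)
      have kz : z * (1) ∈ S := mq S.zero_mem (by rw [hz, zero_mul])
      exact ⟨kx, ky, kz⟩
    · have kx : x * (y) ∈ S := mq m_1_1_0 (by ring)
      have ky : y * (y) ∈ S := mq m_0_2_0 (by ring)
      have kz : z * (y) ∈ S := mq S.zero_mem (by rw [hz, zero_mul])
      exact ⟨kx, ky, kz⟩
    · have kx : x * (y ^ 2) ∈ S := mq m_1_2_0 (by ring)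
      have ky : y * (y ^ 2) ∈ S := mq m_0_3_0 (by ring)
      have kz : z * (y ^ 2) ∈ S := mq S.zero_mem (by rw [hz, zero_mul])
      exact ⟨kx, ky, kz⟩
    · have kx : x * (y ^ 3) ∈ S := mq m_1_3_0 (by ring)
      have ky : y * (y ^ 3) ∈ S := mq m_0_4_0 (by ring)
      have kz : z * (y ^ 3) ∈ S := mq S.zero_mem (by rw [hz, zero_mul])
      exact ⟨kx, ky, kz⟩
    · have kx : x * (y ^ 4) ∈ S := mq m_1_4_0 (by ring)
      have ky : y * (y ^ 4) ∈ S := mq m_0_5_0 (by ring)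
      have kz : z * (y ^ 4) ∈ S := mq S.zero_mem (by rw [hz, zero_mul])
      exact ⟨kx, ky, kz⟩
    · have kx : x * (y ^ 5) ∈ S := mq m_1_5_0 (by ring)
      have ky : y * (y ^ 5) ∈ S := mq m_0_6_0 (by ring)
      have kz : z * (y ^ 5) ∈ S := mq S.zero_mem (by rw [hz, zero_mul])
      exact ⟨kx, ky, kz⟩
    · have kx : x * (y ^ 6) ∈ S := mq m_1_6_0 (by ring)
      have ky : y * (y ^ 6) ∈ S := mq m_0_7_0 (by ring)
      have kz : z * (y ^ 6) ∈ S := mq S.zero_mem (by rw [hz, zero_mul])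
      exact ⟨kx, ky, kz⟩
    · have kx : x * (x) ∈ S := mq m_2_0_0 (by ring)
      have ky : y * (x) ∈ S := mq m_1_1_0 (by ring)
      have kz : z * (x) ∈ S := mq S.zero_mem (by rw [hz, zero_mul])
      exact ⟨kx, ky, kz⟩
    · have kx : x * (x * y) ∈ S := mq m_2_1_0 (by ring)
      have ky : y * (x * y) ∈ S := mq m_1_2_0 (by ring)
      have kz : z * (x * y) ∈ S := mq S.zero_mem (by rw [hz, zero_mul])
      exact ⟨kx, ky, kz⟩
    · have kx : x * (x * y ^ 2) ∈ S := mq m_2_2_0 (by ring)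
      have ky : y * (x * y ^ 2) ∈ S := mq m_1_3_0 (by ring)
      have kz : z * (x * y ^ 2) ∈ S := mq S.zero_mem (by rw [hz, zero_mul])
      exact ⟨kx, ky, kz⟩
    · have kx : x * (x * y ^ 3) ∈ S := mq m_2_3_0 (by ring)
      have ky : y * (x * y ^ 3) ∈ S := mq m_1_4_0 (by ring)
      have kz : z * (x * y ^ 3) ∈ S := mq S.zero_mem (by rw [hz, zero_mul])
      exact ⟨kx, ky, kz⟩
    · have kx : x * (x * y ^ 4) ∈ S := mq m_2_4_0 (by ring)
      have ky : y * (x * y ^ 4) ∈ S := mq m_1_5_0 (by ring)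
      have kz : z * (x * y ^ 4) ∈ S := mq S.zero_mem (by rw [hz, zero_mul])
      exact ⟨kx, ky, kz⟩
    · have kx : x * (x * y ^ 5) ∈ S := mq m_2_5_0 (by ring)
      have ky : y * (x * y ^ 5) ∈ S := mq m_1_6_0 (by ring)
      have kz : z * (x * y ^ 5) ∈ S := mq S.zero_mem (by rw [hz, zero_mul])
      exact ⟨kx, ky, kz⟩

lemma cert_1_7 {Q : Type*} [CommRing Q] [Algebra ℂ Q] (x y : Q)
    (hx : x * (x ^ 3 + x ^ 2 * y ^ 2 + y ^ 7) = 0)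
    (hy : y * (x ^ 3 + x ^ 2 * y ^ 2 + y ^ 7) = 0)
    (hh : 3 * x ^ 3 + 6 * x ^ 2 * y - 4 * x ^ 3 * y + 4 * x * y ^ 3 - 14 * x * y ^ 6 - 7 * y ^ 7 = 0)
    (h10 : y ^ 10 = 0) : x * y ^ 7 = 0 := by
  have c15 := cert_1_5 x y hx hy hh h10
  apply kz 529120 (by norm_num)
  push_cast at c15 ⊢
  linear_combination y ^ 2 * c15 + (2381040 + 2513320 * y) * h10

lemma cert_x5 {Q : Type*} [CommRing Q] [Algebra ℂ Q] (x y : Q)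
    (hx : x * (x ^ 3 + x ^ 2 * y ^ 2 + y ^ 7) = 0)
    (hy : y * (x ^ 3 + x ^ 2 * y ^ 2 + y ^ 7) = 0)
    (hh : 3 * x ^ 3 + 6 * x ^ 2 * y - 4 * x ^ 3 * y + 4 * x * y ^ 3 - 14 * x * y ^ 6 - 7 * y ^ 7 = 0)
    (h10 : y ^ 10 = 0) : x ^ 5 = 0 := by
  have c40 := cert_4_0 x y hx hy hh h10
  have c17 := cert_1_7 x y hx hy hh h10
  apply kz 264560 (by norm_num)
  push_cast at c40 ⊢
  linear_combination x * c40 + (-529120) * y ^ 2 * c17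

lemma closure2 {Q : Type*} [CommRing Q] [Algebra ℂ Q] (x y z : Q) (b : Fin 18 → Q)
    (hb : b = ![1, x, x ^ 2, x ^ 3, y, y ^ 2, y ^ 3, y ^ 4, y ^ 5, y ^ 6, y ^ 7, y ^ 8, y ^ 9, x * y, x * y ^ 2, x * y ^ 3, x * y ^ 4, z])
    (hzx : x * z = 0) (hzy : y * z = 0)
    (hf : x ^ 3 + x ^ 2 * y ^ 2 + y ^ 7 + z ^ 2 = 0)
    (hx : x * (x ^ 3 + x ^ 2 * y ^ 2 + y ^ 7) = 0)
    (hy : y * (x ^ 3 + x ^ 2 * y ^ 2 + y ^ 7) = 0)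
    (hh : 3 * x ^ 3 + 6 * x ^ 2 * y - 4 * x ^ 3 * y + 4 * x * y ^ 3 - 14 * x * y ^ 6 - 7 * y ^ 7 = 0)
    (h10 : y ^ 10 = 0)
    (h17 : x * y ^ 7 = 0) :
    ∀ a ∈ Submodule.span ℂ (Set.range b), x * a ∈ Submodule.span ℂ (Set.range b) ∧
      y * a ∈ Submodule.span ℂ (Set.range b) ∧ z * a ∈ Submodule.span ℂ (Set.range b) := by
  set S := Submodule.span ℂ (Set.range b) with hS
  have m : ∀ i, b i ∈ S := fun i => Submodule.subset_span ⟨i, rfl⟩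
  subst hb
  have m_0_0_0 : 1 ∈ S := m 0
  have m_1_0_0 : x ∈ S := m 1
  have m_2_0_0 : x ^ 2 ∈ S := m 2
  have m_3_0_0 : x ^ 3 ∈ S := m 3
  have m_0_1_0 : y ∈ S := m 4
  have m_0_2_0 : y ^ 2 ∈ S := m 5
  have m_0_3_0 : y ^ 3 ∈ S := m 6
  have m_0_4_0 : y ^ 4 ∈ S := m 7
  have m_0_5_0 : y ^ 5 ∈ S := m 8
  have m_0_6_0 : y ^ 6 ∈ S := m 9
  have m_0_7_0 : y ^ 7 ∈ S := m 10
  have m_0_8_0 : y ^ 8 ∈ S := m 11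
  have m_0_9_0 : y ^ 9 ∈ S := m 12
  have m_1_1_0 : x * y ∈ S := m 13
  have m_1_2_0 : x * y ^ 2 ∈ S := m 14
  have m_1_3_0 : x * y ^ 3 ∈ S := m 15
  have m_1_4_0 : x * y ^ 4 ∈ S := m 16
  have m_0_0_1 : z ∈ S := m 17
  have c15 := cert_1_5 x y hx hy hh h10
  have m_1_5_0 : x * y ^ 5 ∈ S := by
    apply kdiv_mem S 529120 (by norm_num)
    rw [c15]
    exact (add_mem (imul S (2381040) m_0_8_0) (imul S (2513320) m_0_9_0))
  have m_1_6_0 : x * y ^ 6 ∈ S := by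
    apply kdiv_mem S 529120 (by norm_num)
    exact mq (imul S (2381040) m_0_9_0) (by push_cast at c15 ⊢; linear_combination y * c15 + 2513320 * h10)
  have m_1_7_0 : x * y ^ 7 ∈ S := mq S.zero_mem h17
  have m_1_8_0 : x * y ^ 8 ∈ S := mq S.zero_mem (by linear_combination y * h17)
  have m_1_9_0 : x * y ^ 9 ∈ S := mq S.zero_mem (by linear_combination y ^ 2 * h17)
  have m_0_10_0 : y ^ 10 ∈ S := mq S.zero_mem h10
  have c24 := cert_2_4 x y hx hy hh h10
  have m_2_4_0 : x ^ 2 * y ^ 4 ∈ S := by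
    apply kdiv_mem S 264560 (by norm_num)
    rw [c24]
    exact (imul S (-793680) m_0_9_0)
  have c23 := cert_2_3 x y hx hy hh h10
  have m_2_3_0 : x ^ 2 * y ^ 3 ∈ S := by
    apply kdiv_mem S 529120 (by norm_num)
    rw [c23]
    exact (add_mem (imul S (-1587360) m_0_8_0) (imul S (-1587360) m_0_9_0))
  have c22 := cert_2_2 x y hx hy hh h10
  have m_2_2_0 : x ^ 2 * y ^ 2 ∈ S := by
    apply kdiv_mem S 634944 (by norm_num)
    rw [c22]
    exact (add_mem (add_mem (imul S (105824) m_0_8_0) (imul S (-105824) m_0_9_0)) (imul S (-423296) m_1_4_0))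
  have c21 := cert_2_1 x y hx hy hh h10
  have m_2_1_0 : x ^ 2 * y ∈ S := by
    apply kdiv_mem S 79368 (by norm_num)
    rw [c21]
    exact (add_mem (add_mem (add_mem (add_mem (imul S (-39684) m_3_0_0) (imul S (92596) m_0_7_0)) (imul S (105824) m_0_8_0)) (imul S (992100) m_0_9_0)) (imul S (-52912) m_1_3_0))
  have c31 := cert_3_1 x y hx hy hh h10
  have m_3_1_0 : x ^ 3 * y ∈ S := by
    apply kdiv_mem S 529120 (by norm_num)
    rw [c31]
    exact (add_mem (imul S (1058240) m_0_8_0) (imul S (1587360) m_0_9_0))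
  have c40 := cert_4_0 x y hx hy hh h10
  have m_4_0_0 : x ^ 4 ∈ S := by
    apply kdiv_mem S 264560 (by norm_num)
    rw [c40]
    exact (imul S (-529120) m_0_9_0)

  intro a ha
  induction ha using Submodule.span_induction with
  | zero => simp
  | add u v _ _ hu hv =>
    simp only [mul_add]
    exact ⟨add_mem hu.1 hv.1, add_mem hu.2.1 hv.2.1, add_mem hu.2.2 hv.2.2⟩
  | smul c u _ hu =>
    simp only [mul_smul_comm]
    exact ⟨S.smul_mem c hu.1, S.smul_mem c hu.2.1, S.smul_mem c hu.2.2⟩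
  | mem u hu =>
    obtain ⟨i, rfl⟩ := hu
    fin_cases i
    · have kx : x * (1) ∈ S := mq m_1_0_0 (by ring)
      have ky : y * (1) ∈ S := mq m_0_1_0 (by ring)
      have kz : z * (1) ∈ S := mq m_0_0_1 (by ring)
      exact ⟨kx, ky, kz⟩
    · have kx : x * (x) ∈ S := mq m_2_0_0 (by ring)
      have ky : y * (x) ∈ S := mq m_1_1_0 (by ring)
      have kz : z * (x) ∈ S := mq S.zero_mem (by linear_combination 1 * hzx)
      exact ⟨kx, ky, kz⟩
    · have kx : x * (x ^ 2) ∈ S := mq m_3_0_0 (by ring)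
      have ky : y * (x ^ 2) ∈ S := mq m_2_1_0 (by ring)
      have kz : z * (x ^ 2) ∈ S := mq S.zero_mem (by linear_combination x * hzx)
      exact ⟨kx, ky, kz⟩
    · have kx : x * (x ^ 3) ∈ S := mq m_4_0_0 (by ring)
      have ky : y * (x ^ 3) ∈ S := mq m_3_1_0 (by ring)
      have kz : z * (x ^ 3) ∈ S := mq S.zero_mem (by linear_combination x ^ 2 * hzx)
      exact ⟨kx, ky, kz⟩
    · have kx : x * (y) ∈ S := mq m_1_1_0 (by ring)
      have ky : y * (y) ∈ S := mq m_0_2_0 (by ring)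
      have kz : z * (y) ∈ S := mq S.zero_mem (by linear_combination 1 * hzy)
      exact ⟨kx, ky, kz⟩
    · have kx : x * (y ^ 2) ∈ S := mq m_1_2_0 (by ring)
      have ky : y * (y ^ 2) ∈ S := mq m_0_3_0 (by ring)
      have kz : z * (y ^ 2) ∈ S := mq S.zero_mem (by linear_combination y * hzy)
      exact ⟨kx, ky, kz⟩
    · have kx : x * (y ^ 3) ∈ S := mq m_1_3_0 (by ring)
      have ky : y * (y ^ 3) ∈ S := mq m_0_4_0 (by ring)
      have kz : z * (y ^ 3) ∈ S := mq S.zero_mem (by linear_combination y ^ 2 * hzy)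
      exact ⟨kx, ky, kz⟩
    · have kx : x * (y ^ 4) ∈ S := mq m_1_4_0 (by ring)
      have ky : y * (y ^ 4) ∈ S := mq m_0_5_0 (by ring)
      have kz : z * (y ^ 4) ∈ S := mq S.zero_mem (by linear_combination y ^ 3 * hzy)
      exact ⟨kx, ky, kz⟩
    · have kx : x * (y ^ 5) ∈ S := mq m_1_5_0 (by ring)
      have ky : y * (y ^ 5) ∈ S := mq m_0_6_0 (by ring)
      have kz : z * (y ^ 5) ∈ S := mq S.zero_mem (by linear_combination y ^ 4 * hzy)
      exact ⟨kx, ky, kz⟩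
    · have kx : x * (y ^ 6) ∈ S := mq m_1_6_0 (by ring)
      have ky : y * (y ^ 6) ∈ S := mq m_0_7_0 (by ring)
      have kz : z * (y ^ 6) ∈ S := mq S.zero_mem (by linear_combination y ^ 5 * hzy)
      exact ⟨kx, ky, kz⟩
    · have kx : x * (y ^ 7) ∈ S := mq m_1_7_0 (by ring)
      have ky : y * (y ^ 7) ∈ S := mq m_0_8_0 (by ring)
      have kz : z * (y ^ 7) ∈ S := mq S.zero_mem (by linear_combination y ^ 6 * hzy)
      exact ⟨kx, ky, kz⟩
    · have kx : x * (y ^ 8) ∈ S := mq m_1_8_0 (by ring)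
      have ky : y * (y ^ 8) ∈ S := mq m_0_9_0 (by ring)
      have kz : z * (y ^ 8) ∈ S := mq S.zero_mem (by linear_combination y ^ 7 * hzy)
      exact ⟨kx, ky, kz⟩
    · have kx : x * (y ^ 9) ∈ S := mq m_1_9_0 (by ring)
      have ky : y * (y ^ 9) ∈ S := mq m_0_10_0 (by ring)
      have kz : z * (y ^ 9) ∈ S := mq S.zero_mem (by linear_combination y ^ 8 * hzy)
      exact ⟨kx, ky, kz⟩
    · have kx : x * (x * y) ∈ S := mq m_2_1_0 (by ring)
      have ky : y * (x * y) ∈ S := mq m_1_2_0 (by ring)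
      have kz : z * (x * y) ∈ S := mq S.zero_mem (by linear_combination y * hzx)
      exact ⟨kx, ky, kz⟩
    · have kx : x * (x * y ^ 2) ∈ S := mq m_2_2_0 (by ring)
      have ky : y * (x * y ^ 2) ∈ S := mq m_1_3_0 (by ring)
      have kz : z * (x * y ^ 2) ∈ S := mq S.zero_mem (by linear_combination y ^ 2 * hzx)
      exact ⟨kx, ky, kz⟩
    · have kx : x * (x * y ^ 3) ∈ S := mq m_2_3_0 (by ring)
      have ky : y * (x * y ^ 3) ∈ S := mq m_1_4_0 (by ring)
      have kz : z * (x * y ^ 3) ∈ S := mq S.zero_mem (by linear_combination y ^ 3 * hzx)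
      exact ⟨kx, ky, kz⟩
    · have kx : x * (x * y ^ 4) ∈ S := mq m_2_4_0 (by ring)
      have ky : y * (x * y ^ 4) ∈ S := mq m_1_5_0 (by ring)
      have kz : z * (x * y ^ 4) ∈ S := mq S.zero_mem (by linear_combination y ^ 4 * hzx)
      exact ⟨kx, ky, kz⟩
    · have kx : x * (z) ∈ S := mq S.zero_mem (by linear_combination hzx)
      have ky : y * (z) ∈ S := mq S.zero_mem (by linear_combination hzy)
      have kz : z * (z) ∈ S := mq (imul S (-1) (add_mem (add_mem m_3_0_0 m_2_2_0) m_0_7_0))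
        (by push_cast; linear_combination hf)
      exact ⟨kx, ky, kz⟩

lemma part1 : Module.finrank ℂ (MvPowerSeries (Fin 3) ℂ ⧸
    (Ideal.span {(X 0 ^ 3 + X 0 ^ 2 * X 1 ^ 2 + X 1 ^ 7 + X 2 ^ 2 : MvPowerSeries (Fin 3) ℂ)}
      ⊔ J2 (X 0 ^ 3 + X 0 ^ 2 * X 1 ^ 2 + X 1 ^ 7 + X 2 ^ 2) (X 1 + X 2 ^ 2))) = 13 := by
  rw [J2_1]
  set I := Ideal.span {(X 0 ^ 3 + X 0 ^ 2 * X 1 ^ 2 + X 1 ^ 7 + X 2 ^ 2 : MvPowerSeries (Fin 3) ℂ),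
      3 * X 0 ^ 2 + 2 * X 0 * X 1 ^ 2,
      (3 * X 0 ^ 2 + 2 * X 0 * X 1 ^ 2) * (2 * X 2),
      (2 * X 0 ^ 2 * X 1 + 7 * X 1 ^ 6) * (2 * X 2) - 2 * X 2} with hI
  have e3 : (3 : ℂ) • (mo 2 0 0) = 3 * mo 2 0 0 := (nat_mul_eq 3 _).symm
  have e2 : (2 : ℂ) • (mo 1 2 0) = 2 * mo 1 2 0 := (nat_mul_eq 2 _).symm
  have kg : (3 * X 0 ^ 2 + 2 * X 0 * X 1 ^ 2 : MvPowerSeries (Fin 3) ℂ) ∈ annK L1 := by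
    have := ann1_g
    rw [e3, e2] at this
    simp only [mo_eq] at this
    convert this using 1
    ring
  have kf : (X 0 ^ 3 + X 0 ^ 2 * X 1 ^ 2 + X 1 ^ 7 + X 2 ^ 2 : MvPowerSeries (Fin 3) ℂ)
      ∈ annK L1 := by
    rw [phi_mo]; simpa only [one_smul] using ann1_f
  have kz : (X 2 : MvPowerSeries (Fin 3) ℂ) ∈ annK L1 := by
    have := ann1_z
    simpa [mo_eq] using this
  have hIK : I ≤ annK L1 := by
    rw [hI, Ideal.span_le]
    rintro f (rfl | rfl | rfl | rfl)
    · exact kf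
    · exact kg
    · exact Ideal.mul_mem_right _ _ kg
    · have : ((2 * X 0 ^ 2 * X 1 + 7 * X 1 ^ 6) * (2 * X 2) - 2 * X 2 : MvPowerSeries (Fin 3) ℂ) =
        ((2 * X 0 ^ 2 * X 1 + 7 * X 1 ^ 6) * 2 - 2) * X 2 := by ring
      rw [this]
      exact Ideal.mul_mem_left _ _ kz
  set x := Ideal.Quotient.mk I (X 0) with hx
  set y := Ideal.Quotient.mk I (X 1) with hy
  set z := Ideal.Quotient.mk I (X 2) with hz
  have rel : ∀ f ∈ I, Ideal.Quotient.mk I f = 0 := fun f hf => Ideal.Quotient.eq_zero_iff_mem.2 hf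
  have rf : x ^ 3 + x ^ 2 * y ^ 2 + y ^ 7 + z ^ 2 = 0 := by
    have := rel (X 0 ^ 3 + X 0 ^ 2 * X 1 ^ 2 + X 1 ^ 7 + X 2 ^ 2)
      (Ideal.subset_span (by simp))
    simpa using this
  have rg : 3 * x ^ 2 + 2 * x * y ^ 2 = 0 := by
    have := rel (3 * X 0 ^ 2 + 2 * X 0 * X 1 ^ 2) (Ideal.subset_span (by simp))
    simpa only [map_add, map_sub, map_neg, map_mul, map_pow, map_ofNat] using this
  have rz : (2 * x ^ 2 * y + 7 * y ^ 6) * (2 * z) - 2 * z = 0 := by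
    have := rel ((2 * X 0 ^ 2 * X 1 + 7 * X 1 ^ 6) * (2 * X 2) - 2 * X 2)
      (Ideal.subset_span (by simp))
    simpa only [map_add, map_sub, map_neg, map_mul, map_pow, map_ofNat] using this
  have z0 : z = 0 := by
    have hu := isUnit_mk I (4 * X 0 ^ 2 * X 1 + 14 * X 1 ^ 6 - 2) (by
      simp only [map_add, map_sub, map_neg, map_mul, map_pow, map_ofNat, constantCoeff_X]; norm_num)
    rw [← hu.mul_right_eq_zero, map_sub, map_add]
    simp only [map_mul, map_pow, map_ofNat]
    linear_combination rz
  have rf' : x ^ 3 + x ^ 2 * y ^ 2 + y ^ 7 = 0 := by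
    linear_combination rf - z * z0
  have h6 : x * y ^ 6 = 0 := by
    have hu := isUnit_mk I (27 * X 1 + 4) (by
      simp only [map_add, map_sub, map_neg, map_mul, map_pow, map_ofNat, constantCoeff_X]; norm_num)
    rw [← hu.mul_right_eq_zero, map_add]
    simp only [map_mul, map_ofNat]
    linear_combination 3 * x * (9 * rf' - (3 * x + y ^ 2) * rg) + 2 * y ^ 4 * rg
  have hb : (fun i => Ideal.Quotient.mk I (b1 i)) =
      ![1, y, y ^ 2, y ^ 3, y ^ 4, y ^ 5, y ^ 6, x, x * y, x * y ^ 2, x * y ^ 3, x * y ^ 4,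
        x * y ^ 5] := by
    funext i
    fin_cases i <;> simp [b1, mo_eq, hx, hy]
  have hc := closure1 x y z _ hb z0 rg rf' h6
  refine finrank_of I 13 b1 L1 (fun f hf => ?_) hb1 (span_top I _ ?_ ?_ ?_)
  · simpa using hIK hf 1
  · refine Submodule.subset_span ⟨0, ?_⟩
    exact congrFun hb 0
  · intro i a ha
    fin_cases i
    · exact (hc a ha).1
    · exact (hc a ha).2.1
    · exact (hc a ha).2.2
  · intro i
    fin_cases i
    · refine ⟨4, ?_⟩
      change x ^ 4 = 0
      apply _root_.kz 27 (by norm_num)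
      push_cast
      linear_combination (9 * x ^ 2 - 6 * x * y ^ 2 + 4 * y ^ 4) * rg - 8 * h6
    · refine ⟨9, ?_⟩
      change y ^ 9 = 0
      apply _root_.kz 9 (by norm_num)
      push_cast
      linear_combination y ^ 2 * (9 * rf' - (3 * x + y ^ 2) * rg) + 2 * h6
    · exact ⟨1, by rw [pow_one]; exact z0⟩

lemma part2 : Module.finrank ℂ (MvPowerSeries (Fin 3) ℂ ⧸
    (Ideal.span {(X 0 ^ 3 + X 0 ^ 2 * X 1 ^ 2 + X 1 ^ 7 + X 2 ^ 2 : MvPowerSeries (Fin 3) ℂ)}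
      ⊔ J2 (X 0 ^ 3 + X 0 ^ 2 * X 1 ^ 2 + X 1 ^ 7 + X 2 ^ 2)
        (X 0 ^ 2 + X 0 * X 1 + X 1 ^ 2))) = 18 := by
  rw [J2_2]
  set I := Ideal.span {(X 0 ^ 3 + X 0 ^ 2 * X 1 ^ 2 + X 1 ^ 7 + X 2 ^ 2 : MvPowerSeries (Fin 3) ℂ),
      3 * X 0 ^ 3 + 6 * X 0 ^ 2 * X 1 - 4 * X 0 ^ 3 * X 1 + 4 * X 0 * X 1 ^ 3 - 14 * X 0 * X 1 ^ 6
        - 7 * X 1 ^ 7,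
      -(2 * X 2 * (2 * X 0 + X 1)),
      -(2 * X 2 * (X 0 + 2 * X 1))} with hI
  have en : ∀ (n : ℕ) [n.AtLeastTwo] (f : MvPowerSeries (Fin 3) ℂ),
      (OfNat.ofNat n : ℂ) • f = OfNat.ofNat n * f := fun n _ f => (nat_mul_eq n f).symm
  have kh : (3 * X 0 ^ 3 + 6 * X 0 ^ 2 * X 1 - 4 * X 0 ^ 3 * X 1 + 4 * X 0 * X 1 ^ 3
      - 14 * X 0 * X 1 ^ 6 - 7 * X 1 ^ 7 : MvPowerSeries (Fin 3) ℂ) ∈ annK L2 := by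
    have := ann2_h
    simp only [neg_smul, en] at this
    simp only [mo_eq] at this
    convert this using 1
    ring
  have kf : (X 0 ^ 3 + X 0 ^ 2 * X 1 ^ 2 + X 1 ^ 7 + X 2 ^ 2 : MvPowerSeries (Fin 3) ℂ)
      ∈ annK L2 := by
    rw [phi_mo]; simpa only [one_smul] using ann2_f
  have kzx : (X 0 * X 2 : MvPowerSeries (Fin 3) ℂ) ∈ annK L2 := by
    have := ann2_zx
    simpa [mo_eq] using this
  have kzy : (X 1 * X 2 : MvPowerSeries (Fin 3) ℂ) ∈ annK L2 := by
    have := ann2_zy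
    simpa [mo_eq] using this
  have hIK : I ≤ annK L2 := by
    rw [hI, Ideal.span_le]
    rintro f (rfl | rfl | rfl | rfl)
    · exact kf
    · exact kh
    · have : (-(2 * X 2 * (2 * X 0 + X 1)) : MvPowerSeries (Fin 3) ℂ) =
        (-4) * (X 0 * X 2) + (-2) * (X 1 * X 2) := by ring
      rw [this]
      exact add_mem (Ideal.mul_mem_left _ _ kzx) (Ideal.mul_mem_left _ _ kzy)
    · have : (-(2 * X 2 * (X 0 + 2 * X 1)) : MvPowerSeries (Fin 3) ℂ) =
        (-2) * (X 0 * X 2) + (-4) * (X 1 * X 2) := by ring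
      rw [this]
      exact add_mem (Ideal.mul_mem_left _ _ kzx) (Ideal.mul_mem_left _ _ kzy)
  set x := Ideal.Quotient.mk I (X 0) with hx
  set y := Ideal.Quotient.mk I (X 1) with hy
  set z := Ideal.Quotient.mk I (X 2) with hz
  have rel : ∀ f ∈ I, Ideal.Quotient.mk I f = 0 := fun f hf => Ideal.Quotient.eq_zero_iff_mem.2 hf
  have rf : x ^ 3 + x ^ 2 * y ^ 2 + y ^ 7 + z ^ 2 = 0 := by
    have := rel (X 0 ^ 3 + X 0 ^ 2 * X 1 ^ 2 + X 1 ^ 7 + X 2 ^ 2)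
      (Ideal.subset_span (by simp))
    simpa using this
  have rh : 3 * x ^ 3 + 6 * x ^ 2 * y - 4 * x ^ 3 * y + 4 * x * y ^ 3 - 14 * x * y ^ 6
      - 7 * y ^ 7 = 0 := by
    have := rel (3 * X 0 ^ 3 + 6 * X 0 ^ 2 * X 1 - 4 * X 0 ^ 3 * X 1 + 4 * X 0 * X 1 ^ 3
      - 14 * X 0 * X 1 ^ 6 - 7 * X 1 ^ 7) (Ideal.subset_span (by simp))
    simpa only [map_add, map_sub, map_mul, map_pow, map_ofNat] using this
  have r1 : -(2 * z * (2 * x + y)) = 0 := by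
    have := rel (-(2 * X 2 * (2 * X 0 + X 1))) (Ideal.subset_span (by simp))
    simpa only [map_add, map_neg, map_mul, map_pow, map_ofNat] using this
  have r2 : -(2 * z * (x + 2 * y)) = 0 := by
    have := rel (-(2 * X 2 * (X 0 + 2 * X 1))) (Ideal.subset_span (by simp))
    simpa only [map_add, map_neg, map_mul, map_pow, map_ofNat] using this
  have hzx : x * z = 0 := by
    apply kz 6 (by norm_num)
    push_cast
    linear_combination r2 - 2 * r1
  have hzy : y * z = 0 := by
    apply kz 6 (by norm_num)
    push_cast
    linear_combination r1 - 2 * r2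
  have rx : x * (x ^ 3 + x ^ 2 * y ^ 2 + y ^ 7) = 0 := by
    linear_combination x * rf - z * hzx
  have ry : y * (x ^ 3 + x ^ 2 * y ^ 2 + y ^ 7) = 0 := by
    linear_combination y * rf - z * hzy
  have h10 : y ^ 10 = 0 := by
    have hu := isUnit_mk I (5392 + (-697266 * X 0 ^ 2 - 14232 * X 0 - 494098 * X 0 * X 1
      - 30374 * X 0 * X 1 ^ 2 - 32536 * X 0 * X 1 ^ 3 + 18128 * X 1 ^ 4 - 17209 * X 1 ^ 3
      - 296996 * X 1 ^ 2 - 13988 * X 1)) (by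
      simp only [map_add, map_sub, map_neg, map_mul, map_pow, map_ofNat, constantCoeff_X]; norm_num)
    rw [← hu.mul_right_eq_zero]
    simp only [map_add, map_sub, map_neg, map_mul, map_pow, map_ofNat]
    exact cert_y10 x y rx ry rh
  have h17 := cert_1_7 x y rx ry rh h10
  have hb : (fun i => Ideal.Quotient.mk I (b2 i)) =
      ![1, x, x ^ 2, x ^ 3, y, y ^ 2, y ^ 3, y ^ 4, y ^ 5, y ^ 6, y ^ 7, y ^ 8, y ^ 9, x * y, x * y ^ 2, x * y ^ 3, x * y ^ 4, z] := by
    funext i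
    fin_cases i <;> simp [b2, mo_eq, hx, hy, hz]
  have hc := closure2 x y z _ hb hzx hzy rf rx ry rh h10 h17
  refine finrank_of I 18 b2 L2 (fun f hf => ?_) hb2 (span_top I _ ?_ ?_ ?_)
  · simpa using hIK hf 1
  · refine Submodule.subset_span ⟨0, ?_⟩
    exact congrFun hb 0
  · intro i a ha
    fin_cases i
    · exact (hc a ha).1
    · exact (hc a ha).2.1
    · exact (hc a ha).2.2
  · intro i
    fin_cases i
    · exact ⟨5, cert_x5 x y rx ry rh h10⟩
    · exact ⟨10, h10⟩
    · refine ⟨3, ?_⟩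
      change z ^ 3 = 0
      linear_combination z * rf - (x ^ 2 + x * y ^ 2) * hzx - y ^ 6 * hzy

theorem stmt13 (φ f₁ f₂ : MvPowerSeries (Fin 3) ℂ)
    (hφ : φ = X 0 ^ 3 + X 0 ^ 2 * X 1 ^ 2 + X 1 ^ 7 + X 2 ^ 2)
    (hf₁ : f₁ = X 1 + X 2 ^ 2)
    (hf₂ : f₂ = X 0 ^ 2 + X 0 * X 1 + X 1 ^ 2) :
    Module.finrank ℂ
        (MvPowerSeries (Fin 3) ℂ ⧸ (Ideal.span {φ} ⊔ J2 φ f₁)) = 13 ∧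
    Module.finrank ℂ
        (MvPowerSeries (Fin 3) ℂ ⧸ (Ideal.span {φ} ⊔ J2 φ f₂)) = 18 := by
  subst hφ hf₁ hf₂
  exact ⟨part1, part2⟩
end
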